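/- arXiv:1909.06565 — 3 statements merged into one kernel-verified Lean document; each statement's English description precedes it below -/
import Mathlib

section
/- For every real σ > 0, the improper integral ∫₀^σ H₀⁽¹⁾(x) dx converges and equals (π/2)·σ·[H₀⁽¹⁾(σ)·𝐇₋₁(σ) + H₁⁽¹⁾(σ)·𝐇₀(σ)]. -/
open MeasureTheory Set Filter Topology Real intervalIntegral

/-- Bessel function of the first kind `J_n(x)` (integral representation). -/
noncomputable def besselJ (n : ℕ) (x : ℝ) : ℝ :=
  (1 / π) * ∫ τ in (0:ℝ)..π, Real.cos (n * τ - x * Real.sin τ)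

/-- Bessel function of the second kind `Y_n(x)` (integral representation). -/
noncomputable def besselY (n : ℕ) (x : ℝ) : ℝ :=
  (1 / π) * (∫ τ in (0:ℝ)..π, Real.sin (x * Real.sin τ - n * τ))
    - (1 / π) * ∫ t in Set.Ioi (0:ℝ),
        (Real.exp (n * t) + (-1 : ℝ) ^ n * Real.exp (-(n * t))) * Real.exp (-x * Real.sinh t)

/-- Hankel function of the first kind `H_n^{(1)}(x) = J_n(x) + i Y_n(x)`. -/
noncomputable def hankelH1 (n : ℕ) (x : ℝ) : ℂ :=
  (besselJ n x : ℂ) + Complex.I * (besselY n x : ℂ)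

/-- Struve function `𝐇₀(x)`. -/
noncomputable def struveH0 (x : ℝ) : ℝ :=
  (2 / π) * ∫ t in (0:ℝ)..1, Real.sin (x * t) / Real.sqrt (1 - t ^ 2)

/-- Struve function `𝐇₁(x)`. -/
noncomputable def struveH1 (x : ℝ) : ℝ :=
  (2 * x / π) * ∫ t in (0:ℝ)..1, Real.sqrt (1 - t ^ 2) * Real.sin (x * t)

/-- Struve function `𝐇₋₁(x) = 2/π − 𝐇₁(x)`. -/
noncomputable def struveHm1 (x : ℝ) : ℝ := 2 / π - struveH1 x

noncomputable def zC (k : ℕ) (x : ℝ) : ℝ := ∫ τ in (0:ℝ)..π, Real.sin τ ^ k * Real.cos (x * Real.sin τ)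
noncomputable def zS (k : ℕ) (x : ℝ) : ℝ := ∫ τ in (0:ℝ)..π, Real.sin τ ^ k * Real.sin (x * Real.sin τ)
noncomputable def zK (k : ℕ) (x : ℝ) : ℝ :=
  ∫ t in Set.Ioi (0:ℝ), Real.sinh t ^ k * Real.exp (-x * Real.sinh t)

lemma zC_deriv (k : ℕ) (x : ℝ) : HasDerivAt (zC k) (-zS (k+1) x) x := by
  have h := (intervalIntegral.hasDerivAt_integral_of_dominated_loc_of_deriv_le (μ := volume)
    (a := 0) (b := π) (bound := fun _ => 1) (x₀ := x) (s := univ)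
    (F := fun x τ => Real.sin τ ^ k * Real.cos (x * Real.sin τ))
    (F' := fun x τ => -(Real.sin τ ^ (k+1) * Real.sin (x * Real.sin τ)))
    univ_mem ?_ ?_ ?_ ?_ ?_ ?_).2
  · rw [intervalIntegral.integral_neg] at h
    exact h
  · exact Eventually.of_forall fun y => (by fun_prop : Continuous _).aestronglyMeasurable
  · exact (by fun_prop : Continuous _).intervalIntegrable _ _
  · exact (by fun_prop : Continuous _).aestronglyMeasurable
  · refine Eventually.of_forall fun t _ y _ => ?_
    rw [norm_neg, norm_mul, norm_pow, Real.norm_eq_abs, Real.norm_eq_abs]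
    exact mul_le_one₀ (pow_le_one₀ (abs_nonneg _) (Real.abs_sin_le_one _)) (abs_nonneg _) (Real.abs_sin_le_one _)
  · exact intervalIntegrable_const
  · refine Eventually.of_forall fun t _ y _ => ?_
    have := ((hasDerivAt_id' y).mul_const (Real.sin t)).cos.const_mul (Real.sin t ^ k)
    exact this.congr_deriv (by ring)

lemma zS_deriv (k : ℕ) (x : ℝ) : HasDerivAt (zS k) (zC (k+1) x) x := by
  refine (intervalIntegral.hasDerivAt_integral_of_dominated_loc_of_deriv_le (μ := volume)
    (a := 0) (b := π) (bound := fun _ => 1) (x₀ := x) (s := univ)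
    (F := fun x τ => Real.sin τ ^ k * Real.sin (x * Real.sin τ))
    (F' := fun x τ => (Real.sin τ ^ (k+1) * Real.cos (x * Real.sin τ)))
    univ_mem ?_ ?_ ?_ ?_ ?_ ?_).2
  · exact Eventually.of_forall fun y => (by fun_prop : Continuous _).aestronglyMeasurable
  · exact (by fun_prop : Continuous _).intervalIntegrable _ _
  · exact (by fun_prop : Continuous _).aestronglyMeasurable
  · refine Eventually.of_forall fun t _ y _ => ?_
    rw [norm_mul, norm_pow, Real.norm_eq_abs, Real.norm_eq_abs]
    exact mul_le_one₀ (pow_le_one₀ (abs_nonneg _) (Real.abs_sin_le_one _)) (abs_nonneg _) (Real.abs_cos_le_one _)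
  · exact intervalIntegrable_const
  · refine Eventually.of_forall fun t _ y _ => ?_
    have := ((hasDerivAt_id' y).mul_const (Real.sin t)).sin.const_mul (Real.sin t ^ k)
    exact this.congr_deriv (by ring)

lemma zK_bound (k : ℕ) {x t : ℝ} (hx : 0 < x) (ht : 0 ≤ t) :
    ‖Real.sinh t ^ k * Real.exp (-x * Real.sinh t)‖ ≤
      (k.factorial * (2 / x) ^ k) * Real.exp (-(x/2) * t) := by
  have hs : t ≤ Real.sinh t := Real.self_le_sinh_iff.2 ht
  have hs0 : 0 ≤ Real.sinh t := ht.trans hs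
  rw [Real.norm_of_nonneg (by positivity)]
  have h1 := Real.pow_div_factorial_le_exp (x / 2 * Real.sinh t) (by positivity) k
  rw [div_le_iff₀ (by positivity)] at h1
  have h2 : Real.sinh t ^ k = (2 / x) ^ k * (x / 2 * Real.sinh t) ^ k := by
    rw [← mul_pow]; congr 1; field_simp
  have h3 : Real.exp (-x * Real.sinh t) = Real.exp (-(x/2) * Real.sinh t) * Real.exp (-(x/2) * Real.sinh t) := by
    rw [← Real.exp_add]; ring_nf
  have h4 : Real.exp (x / 2 * Real.sinh t) * Real.exp (-(x/2) * Real.sinh t) = 1 := by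
    rw [← Real.exp_add]; simp
  have h5 : Real.exp (-(x/2) * Real.sinh t) ≤ Real.exp (-(x/2) * t) := by
    apply Real.exp_le_exp.2
    nlinarith
  calc _ = (2 / x) ^ k * ((x / 2 * Real.sinh t) ^ k) * (Real.exp (-(x/2) * Real.sinh t) * Real.exp (-(x/2) * Real.sinh t)) := by
        rw [← h2, ← h3]
    _ ≤ (2 / x) ^ k * (Real.exp (x / 2 * Real.sinh t) * k.factorial) * (Real.exp (-(x/2) * Real.sinh t) * Real.exp (-(x/2) * Real.sinh t)) := by gcongr
    _ = (k.factorial * (2 / x) ^ k) * (Real.exp (x / 2 * Real.sinh t) * Real.exp (-(x/2) * Real.sinh t)) * Real.exp (-(x/2) * Real.sinh t) := by ring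
    _ ≤ _ := by rw [h4, mul_one]; gcongr

lemma zK_bound_int (k : ℕ) {x : ℝ} (hx : 0 < x) :
    IntegrableOn (fun t => (k.factorial * (2 / x) ^ k) * Real.exp (-(x/2) * t)) (Ioi 0) :=
  (integrableOn_exp_mul_Ioi (by linarith) 0).const_mul _

lemma zK_integrable (k : ℕ) {x : ℝ} (hx : 0 < x) :
    IntegrableOn (fun t => Real.sinh t ^ k * Real.exp (-x * Real.sinh t)) (Ioi 0) := by
  refine Integrable.mono' (zK_bound_int k hx) ?_ ?_
  · exact (by fun_prop : Continuous _).aestronglyMeasurable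
  · filter_upwards [ae_restrict_mem measurableSet_Ioi] with t ht
    exact zK_bound k hx (le_of_lt ht)

lemma zK_deriv (k : ℕ) {x : ℝ} (hx : 0 < x) : HasDerivAt (zK k) (-zK (k+1) x) x := by
  have h := (_root_.hasDerivAt_integral_of_dominated_loc_of_deriv_le (μ := volume.restrict (Ioi (0:ℝ)))
    (bound := fun t => ((k+1).factorial * (2 / (x/2)) ^ (k+1)) * Real.exp (-((x/2)/2) * t)) (x₀ := x) (s := Ioi (x/2))
    (F := fun x t => Real.sinh t ^ k * Real.exp (-x * Real.sinh t))
    (F' := fun x t => -(Real.sinh t ^ (k+1) * Real.exp (-x * Real.sinh t)))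
    (Ioi_mem_nhds (by linarith)) ?_ ?_ ?_ ?_ ?_ ?_).2
  · rw [MeasureTheory.integral_neg] at h
    exact h
  · exact Eventually.of_forall fun y => (by fun_prop : Continuous _).aestronglyMeasurable
  · exact zK_integrable k hx
  · exact (by fun_prop : Continuous _).aestronglyMeasurable
  · filter_upwards [ae_restrict_mem measurableSet_Ioi] with t ht y hy
    have ht0 : (0:ℝ) < t := ht
    have hy' : x / 2 < y := hy
    have hs : 0 ≤ Real.sinh t := Real.sinh_nonneg_iff.2 ht0.le
    refine le_trans ?_ (zK_bound (k+1) (half_pos hx) ht0.le)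
    rw [norm_neg, Real.norm_of_nonneg (by positivity), Real.norm_of_nonneg (by positivity)]
    gcongr
  · exact zK_bound_int (k+1) (half_pos hx)
  · refine Eventually.of_forall fun t y _ => ?_
    have := ((hasDerivAt_neg' y).mul_const (Real.sinh t)).exp.const_mul (Real.sinh t ^ k)
    exact this.congr_deriv (by ring)

lemma zC_ibp (x : ℝ) : x * (zC 0 x - zC 2 x) = zS 1 x := by
  have h := intervalIntegral.integral_eq_sub_of_hasDerivAt (a := 0) (b := π)
    (f := fun τ => Real.cos τ * Real.sin (x * Real.sin τ))
    (f' := fun τ => x * (Real.sin τ ^ 0 * Real.cos (x * Real.sin τ) - Real.sin τ ^ 2 * Real.cos (x * Real.sin τ))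
      - Real.sin τ ^ 1 * Real.sin (x * Real.sin τ)) ?_ ?_
  · rw [intervalIntegral.integral_sub, intervalIntegral.integral_const_mul, intervalIntegral.integral_sub] at h
    · simp only [sin_pi, sin_zero, mul_zero, sub_zero] at h
      unfold zC zS
      linarith
    all_goals exact (by fun_prop : Continuous _).intervalIntegrable _ _
  · intro τ _
    have := (Real.hasDerivAt_cos τ).mul ((Real.hasDerivAt_sin τ).const_mul x).sin
    refine this.congr_deriv ?_
    linear_combination (x * Real.cos (x * Real.sin τ)) * Real.sin_sq_add_cos_sq τ
  · exact (by fun_prop : Continuous _).intervalIntegrable _ _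

lemma zS_ibp (x : ℝ) : x * (zS 0 x - zS 2 x) = 2 - zC 1 x := by
  have h := intervalIntegral.integral_eq_sub_of_hasDerivAt (a := 0) (b := π)
    (f := fun τ => -(Real.cos τ * Real.cos (x * Real.sin τ)))
    (f' := fun τ => x * (Real.sin τ ^ 0 * Real.sin (x * Real.sin τ) - Real.sin τ ^ 2 * Real.sin (x * Real.sin τ))
      + Real.sin τ ^ 1 * Real.cos (x * Real.sin τ)) ?_ ?_
  · rw [intervalIntegral.integral_add, intervalIntegral.integral_const_mul, intervalIntegral.integral_sub] at h
    · simp only [sin_pi, sin_zero, mul_zero, cos_pi, cos_zero] at h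
      unfold zC zS
      linarith
    all_goals exact (by fun_prop : Continuous _).intervalIntegrable _ _
  · intro τ _
    have := ((Real.hasDerivAt_cos τ).mul ((Real.hasDerivAt_sin τ).const_mul x).cos).neg
    refine this.congr_deriv ?_
    linear_combination (x * Real.sin (x * Real.sin τ)) * Real.sin_sq_add_cos_sq τ
  · exact (by fun_prop : Continuous _).intervalIntegrable _ _

lemma zK_tendsto (k : ℕ) {x : ℝ} (hx : 0 < x) :
    Tendsto (fun t => Real.sinh t ^ k * Real.exp (-x * Real.sinh t)) atTop (𝓝 0) := by
  refine squeeze_zero_norm' (a := fun t => (k.factorial * (2 / x) ^ k) * Real.exp (-(x/2) * t)) ?_ ?_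
  · filter_upwards [eventually_ge_atTop 0] with t ht using zK_bound k hx ht
  · rw [← mul_zero ((k.factorial : ℝ) * (2 / x) ^ k)]
    refine Tendsto.const_mul _ (Real.tendsto_exp_atBot.comp ?_)
    exact tendsto_id.const_mul_atTop_of_neg (by linarith)

lemma zK_ibp {x : ℝ} (hx : 0 < x) : x * (zK 0 x + zK 2 x) = 1 + zK 1 x := by
  have i0 := zK_integrable 0 hx
  have i1 := zK_integrable 1 hx
  have i2 := zK_integrable 2 hx
  have i3 : IntegrableOn (fun t => x * (Real.sinh t ^ 0 * Real.exp (-x * Real.sinh t) + Real.sinh t ^ 2 * Real.exp (-x * Real.sinh t))) (Ioi 0) := (i0.add i2).const_mul x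
  have h := MeasureTheory.integral_Ioi_of_hasDerivAt_of_tendsto' (a := 0) (m := 0)
    (f := fun t => -(Real.cosh t * Real.exp (-x * Real.sinh t)))
    (f' := fun t => x * (Real.sinh t ^ 0 * Real.exp (-x * Real.sinh t) + Real.sinh t ^ 2 * Real.exp (-x * Real.sinh t))
      - Real.sinh t ^ 1 * Real.exp (-x * Real.sinh t)) ?_ (i3.sub i1) ?_
  · have e1 := MeasureTheory.integral_sub i3 i1
    have e2 := MeasureTheory.integral_const_mul (μ := volume.restrict (Ioi (0:ℝ))) x ((fun t => Real.sinh t ^ 0 * Real.exp (-x * Real.sinh t)) + (fun t => Real.sinh t ^ 2 * Real.exp (-x * Real.sinh t)))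
    have e3 := MeasureTheory.integral_add i0 i2
    simp only [Pi.add_apply] at e1 e2
    rw [e1, e2, e3] at h
    simp only [sinh_zero, mul_zero, cosh_zero, exp_zero] at h
    unfold zK
    linarith
  · intro t _
    have := ((Real.hasDerivAt_cosh t).mul ((Real.hasDerivAt_sinh t).const_mul (-x)).exp).neg
    refine this.congr_deriv ?_
    linear_combination (x * Real.exp (-x * Real.sinh t)) * Real.cosh_sq t
  · have h01 := (zK_tendsto 0 hx).add (zK_tendsto 1 hx)
    rw [add_zero] at h01
    refine squeeze_zero_norm' ?_ h01
    filter_upwards [eventually_ge_atTop 0] with t ht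
    have hs : 0 ≤ Real.sinh t := Real.sinh_nonneg_iff.2 ht
    have hc := Real.cosh_pos t
    rw [norm_neg, Real.norm_of_nonneg (by positivity), ← add_mul]
    gcongr
    have := Real.cosh_sq t
    nlinarith

lemma zK_nonneg (k : ℕ) (x : ℝ) : 0 ≤ zK k x := by
  unfold zK
  refine setIntegral_nonneg measurableSet_Ioi fun t ht => ?_
  have hs : 0 ≤ Real.sinh t := Real.sinh_nonneg_iff.2 (le_of_lt ht)
  positivity

lemma zK0_le {x : ℝ} (hx : 0 < x) : zK 0 x ≤ √π * x ^ (-(1/2) : ℝ) := by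
  have h := setIntegral_mono_on (zK_integrable 0 hx)
    (integrable_exp_neg_mul_sq (b := x/4) (by positivity)).integrableOn measurableSet_Ioi
    (fun t (ht : 0 < t) => by
      have h1 := Real.quadratic_le_exp_of_nonneg ht.le
      have h2 : Real.exp (-t) ≤ 1 := Real.exp_le_one_iff.2 (by linarith)
      have h3 : t ^ 2 / 4 ≤ Real.sinh t := by rw [Real.sinh_eq]; linarith
      rw [pow_zero, one_mul]
      apply Real.exp_le_exp.2
      nlinarith)
  rw [integral_gaussian_Ioi] at h
  refine h.trans (le_of_eq ?_)
  rw [Real.rpow_neg hx.le, ← Real.sqrt_eq_rpow, show π / (x/4) = 2^2 * (π / x) by ring,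
    Real.sqrt_mul (by positivity), Real.sqrt_sq (by norm_num), Real.sqrt_div (by positivity)]
  ring

lemma zK1_le {x : ℝ} (hx : 0 < x) : x * zK 1 x ≤ 2 * zK 0 (x/2) := by
  unfold zK
  rw [← MeasureTheory.integral_const_mul, ← MeasureTheory.integral_const_mul]
  refine setIntegral_mono_on ((zK_integrable 1 hx).const_mul x)
    ((zK_integrable 0 (half_pos hx)).const_mul 2) measurableSet_Ioi (fun t (ht : 0 < t) => ?_)
  have h1 := Real.add_one_le_exp (x / 2 * Real.sinh t)
  have h3 : Real.exp (-x * Real.sinh t) = Real.exp (-(x/2) * Real.sinh t) * Real.exp (-(x/2) * Real.sinh t) := by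
    rw [← Real.exp_add]; ring_nf
  have h4 : Real.exp (x / 2 * Real.sinh t) * Real.exp (-(x/2) * Real.sinh t) = 1 := by
    rw [← Real.exp_add]; simp
  have hp := Real.exp_pos (-(x/2) * Real.sinh t)
  rw [h3, pow_zero, pow_one]
  have : x * Real.sinh t * Real.exp (-(x/2) * Real.sinh t) ≤ 2 := by nlinarith
  nlinarith

lemma zS0_le (x : ℝ) : ‖zS 0 x‖ ≤ π * |x| := by
  have h := intervalIntegral.norm_integral_le_of_norm_le_const (a := 0) (b := π) (C := |x|)
    (f := fun τ => Real.sin τ ^ 0 * Real.sin (x * Real.sin τ)) (fun τ _ => by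
      rw [pow_zero, one_mul, Real.norm_eq_abs]
      calc _ ≤ |x * Real.sin τ| := Real.abs_sin_le_abs
        _ = |x| * |Real.sin τ| := abs_mul _ _
        _ ≤ _ := mul_le_of_le_one_right (abs_nonneg _) (Real.abs_sin_le_one _))
  rw [sub_zero, abs_of_pos Real.pi_pos] at h
  unfold zS
  linarith

lemma zC1_le (x : ℝ) : ‖zC 1 x‖ ≤ π := by
  have h := intervalIntegral.norm_integral_le_of_norm_le_const (a := 0) (b := π) (C := 1)
    (f := fun τ => Real.sin τ ^ 1 * Real.cos (x * Real.sin τ)) (fun τ _ => by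
      rw [pow_one, norm_mul, Real.norm_eq_abs, Real.norm_eq_abs]
      exact mul_le_one₀ (Real.abs_sin_le_one _) (abs_nonneg _) (Real.abs_cos_le_one _))
  rw [sub_zero, abs_of_pos Real.pi_pos] at h
  unfold zC
  linarith

lemma int_half (f : ℝ → ℝ) (hf : Continuous f) :
    ∫ τ in (0:ℝ)..π, f (Real.sin τ) = 2 * ∫ τ in (0:ℝ)..(π/2), f (Real.sin τ) := by
  have hc : Continuous fun τ => f (Real.sin τ) := by fun_prop
  rw [← intervalIntegral.integral_add_adjacent_intervals (hc.intervalIntegrable 0 (π/2)) (hc.intervalIntegrable (π/2) π)]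
  have := intervalIntegral.integral_comp_sub_left (a := π/2) (b := π) (fun τ => f (Real.sin τ)) π
  simp only [Real.sin_pi_sub, sub_self] at this
  rw [this, show π - π/2 = π/2 by ring]
  ring

lemma int_subst (g : ℝ → ℝ) :
    ∫ t in (0:ℝ)..1, g t = ∫ τ in (0:ℝ)..(π/2), Real.cos τ * g (Real.sin τ) := by
  have hpi := Real.pi_pos
  have him : Real.sin '' Ioo 0 (π/2) = Ioo 0 1 := by
    ext y
    constructor
    · rintro ⟨θ, ⟨h0, h1⟩, rfl⟩
      refine ⟨Real.sin_pos_of_pos_of_lt_pi h0 (by linarith), ?_⟩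
      rw [← Real.sin_pi_div_two]
      exact Real.sin_lt_sin_of_lt_of_le_pi_div_two (by linarith) le_rfl h1
    · rintro ⟨h0, h1⟩
      exact ⟨Real.arcsin y, ⟨Real.arcsin_pos.2 h0, Real.arcsin_lt_pi_div_two.2 h1⟩,
        Real.sin_arcsin (by linarith) h1.le⟩
  have h := MeasureTheory.integral_image_eq_integral_abs_deriv_smul (s := Ioo 0 (π/2)) (f := Real.sin)
    (f' := Real.cos) measurableSet_Ioo (fun x _ => (Real.hasDerivAt_sin x).hasDerivWithinAt)
    (Real.injOn_sin.mono (fun x hx => ⟨by linarith [hx.1], hx.2.le⟩ : Ioo 0 (π/2) ⊆ Icc (-(π/2)) (π/2))) g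
  rw [him] at h
  rw [intervalIntegral.integral_of_le zero_le_one, intervalIntegral.integral_of_le (by positivity),
    MeasureTheory.integral_Ioc_eq_integral_Ioo, MeasureTheory.integral_Ioc_eq_integral_Ioo, h]
  refine setIntegral_congr_fun measurableSet_Ioo fun τ hτ => ?_
  simp only [smul_eq_mul]
  rw [abs_of_pos (Real.cos_pos_of_mem_Ioo ⟨by linarith [hτ.1], hτ.2⟩)]

lemma struveH0_eq (x : ℝ) : struveH0 x = zS 0 x / π := by
  have e : zS 0 x = 2 * ∫ τ in (0:ℝ)..(π/2), Real.sin (x * Real.sin τ) := by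
    rw [← int_half (fun s => Real.sin (x * s)) (by fun_prop)]
    simp [zS]
  rw [e, struveH0, int_subst]
  have : ∫ τ in (0:ℝ)..(π/2), Real.cos τ * (Real.sin (x * Real.sin τ) / √(1 - Real.sin τ ^ 2))
      = ∫ τ in (0:ℝ)..(π/2), Real.sin (x * Real.sin τ) := by
    rw [intervalIntegral.integral_of_le (by positivity), intervalIntegral.integral_of_le (by positivity),
      MeasureTheory.integral_Ioc_eq_integral_Ioo, MeasureTheory.integral_Ioc_eq_integral_Ioo]
    refine setIntegral_congr_fun measurableSet_Ioo fun τ hτ => ?_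
    have hc := Real.cos_pos_of_mem_Ioo (x := τ) ⟨by linarith [hτ.1, Real.pi_pos], hτ.2⟩
    beta_reduce
    rw [← Real.cos_sq', Real.sqrt_sq hc.le]
    field_simp
  rw [this]; ring

lemma struveHm1_eq (x : ℝ) : struveHm1 x = zC 1 x / π := by
  have e : zS 0 x - zS 2 x = 2 * ∫ τ in (0:ℝ)..(π/2), (1 - Real.sin τ ^ 2) * Real.sin (x * Real.sin τ) := by
    rw [← int_half (fun s => (1 - s ^ 2) * Real.sin (x * s)) (by fun_prop), zS, zS,
      ← intervalIntegral.integral_sub]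
    · congr 1; ext τ; ring
    all_goals exact (by fun_prop : Continuous _).intervalIntegrable _ _
  have : ∫ τ in (0:ℝ)..(π/2), Real.cos τ * (√(1 - Real.sin τ ^ 2) * Real.sin (x * Real.sin τ))
      = ∫ τ in (0:ℝ)..(π/2), (1 - Real.sin τ ^ 2) * Real.sin (x * Real.sin τ) := by
    refine intervalIntegral.integral_congr fun τ hτ => ?_
    rw [uIcc_of_le (by positivity)] at hτ
    have hc := Real.cos_nonneg_of_mem_Icc (x := τ) ⟨by linarith [hτ.1, Real.pi_pos], hτ.2⟩
    beta_reduce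
    rw [← Real.cos_sq', Real.sqrt_sq hc]
    ring
  have h := zS_ibp x
  rw [struveHm1, struveH1, int_subst, this]
  rw [e] at h
  field_simp
  linarith

lemma odd_cos (x : ℝ) : ∫ τ in (0:ℝ)..π, Real.cos τ * Real.cos (x * Real.sin τ) = 0 := by
  have := intervalIntegral.integral_comp_sub_left (a := 0) (b := π) (fun τ => Real.cos τ * Real.cos (x * Real.sin τ)) π
  simp only [Real.sin_pi_sub, Real.cos_pi_sub, sub_self, sub_zero, neg_mul, intervalIntegral.integral_neg] at this
  linarith

lemma odd_sin (x : ℝ) : ∫ τ in (0:ℝ)..π, Real.cos τ * Real.sin (x * Real.sin τ) = 0 := by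
  have := intervalIntegral.integral_comp_sub_left (a := 0) (b := π) (fun τ => Real.cos τ * Real.sin (x * Real.sin τ)) π
  simp only [Real.sin_pi_sub, Real.cos_pi_sub, sub_self, sub_zero, neg_mul, intervalIntegral.integral_neg] at this
  linarith

lemma J0_eq (x : ℝ) : besselJ 0 x = zC 0 x / π := by
  simp [besselJ, zC]; ring

lemma J1_eq (x : ℝ) : besselJ 1 x = zS 1 x / π := by
  have : ∫ τ in (0:ℝ)..π, Real.cos ((1:ℕ) * τ - x * Real.sin τ) = zS 1 x := by
    have h : ∀ τ, Real.cos ((1:ℕ) * τ - x * Real.sin τ) =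
      Real.cos τ * Real.cos (x * Real.sin τ) + Real.sin τ ^ 1 * Real.sin (x * Real.sin τ) := fun τ => by
        rw [Nat.cast_one, one_mul, pow_one, Real.cos_sub]
    simp_rw [h]
    rw [intervalIntegral.integral_add, odd_cos, zero_add, zS]
    all_goals exact (by fun_prop : Continuous _).intervalIntegrable _ _
  rw [besselJ, this]; ring

lemma Y0_eq (x : ℝ) : besselY 0 x = (zS 0 x - 2 * zK 0 x) / π := by
  have h : ∫ t in Set.Ioi (0:ℝ),
        (Real.exp ((0:ℕ) * t) + (-1 : ℝ) ^ 0 * Real.exp (-((0:ℕ) * t))) * Real.exp (-x * Real.sinh t)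
        = 2 * zK 0 x := by
    rw [zK, ← MeasureTheory.integral_const_mul]
    congr 1; ext t; simp; ring
  rw [besselY, h]
  simp [zS]; ring

lemma Y1_eq (x : ℝ) : besselY 1 x = (- zC 1 x - 2 * zK 1 x) / π := by
  have h : ∫ t in Set.Ioi (0:ℝ),
        (Real.exp ((1:ℕ) * t) + (-1 : ℝ) ^ 1 * Real.exp (-((1:ℕ) * t))) * Real.exp (-x * Real.sinh t)
        = 2 * zK 1 x := by
    rw [zK, ← MeasureTheory.integral_const_mul]
    congr 1; ext t; rw [Real.sinh_eq]; simp; ring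
  have : ∫ τ in (0:ℝ)..π, Real.sin (x * Real.sin τ - (1:ℕ) * τ) = - zC 1 x := by
    have h : ∀ τ, Real.sin (x * Real.sin τ - (1:ℕ) * τ) =
      Real.cos τ * Real.sin (x * Real.sin τ) - Real.sin τ ^ 1 * Real.cos (x * Real.sin τ) := fun τ => by
        rw [Nat.cast_one, one_mul, pow_one, Real.sin_sub]; ring
    simp_rw [h]
    rw [intervalIntegral.integral_sub, odd_sin, zero_sub, zC]
    all_goals exact (by fun_prop : Continuous _).intervalIntegrable _ _
  rw [besselY, h, this]; ring

lemma J_part (σ : ℝ) :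
    IntervalIntegrable (besselJ 0) volume 0 σ ∧
    ∫ x in (0:ℝ)..σ, besselJ 0 x = π / 2 * σ * (besselJ 0 σ * struveHm1 σ + besselJ 1 σ * struveH0 σ) := by
  have hi : IntervalIntegrable (besselJ 0) volume 0 σ := by
    have : besselJ 0 = fun x => zC 0 x / π := funext J0_eq
    rw [this]
    have hc : Continuous (zC 0) := continuous_iff_continuousAt.2 fun x => (zC_deriv 0 x).continuousAt
    exact (hc.div_const _).intervalIntegrable _ _
  refine ⟨hi, ?_⟩
  rw [intervalIntegral.integral_eq_sub_of_hasDerivAt (f := fun x => x * (zC 0 x * zC 1 x + zS 1 x * zS 0 x) / (2 * π)) ?_ hi]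
  · rw [J0_eq, J1_eq, struveHm1_eq, struveH0_eq]
    field_simp
    ring
  · intro x _
    have := ((hasDerivAt_id' x).mul (((zC_deriv 0 x).mul (zC_deriv 1 x)).add ((zS_deriv 1 x).mul (zS_deriv 0 x)))).div_const (2 * π)
    refine this.congr_deriv ?_
    rw [J0_eq]
    have h1 := zC_ibp x
    have h2 := zS_ibp x
    have h3 : x * zC 2 x = x * zC 0 x - zS 1 x := by linarith
    have h4 : x * zS 2 x = x * zS 0 x - 2 + zC 1 x := by linarith
    simp only [Pi.mul_apply, Pi.add_apply, zero_add, Nat.reduceAdd]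
    field_simp
    linear_combination (zS 0 x) * h3 - zC 0 x * h4

lemma Y_part (σ : ℝ) (hσ : 0 < σ) :
    IntervalIntegrable (besselY 0) volume 0 σ ∧
    ∫ x in (0:ℝ)..σ, besselY 0 x = π / 2 * σ * (besselY 0 σ * struveHm1 σ + besselY 1 σ * struveH0 σ) := by
  have hK : IntervalIntegrable (zK 0) volume 0 σ := by
    refine ((intervalIntegral.intervalIntegrable_rpow' (r := -(1/2)) (by norm_num)).const_mul (√π)).mono_fun' ?_ ?_
    · refine ContinuousOn.aestronglyMeasurable ?_ measurableSet_uIoc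
      intro x hx
      rw [uIoc_of_le hσ.le] at hx
      exact (zK_deriv 0 hx.1).continuousAt.continuousWithinAt
    · filter_upwards [ae_restrict_mem measurableSet_uIoc] with x hx
      rw [uIoc_of_le hσ.le] at hx
      rw [Real.norm_of_nonneg (zK_nonneg _ _)]
      exact zK0_le hx.1
  have hi : IntervalIntegrable (besselY 0) volume 0 σ := by
    have : besselY 0 = fun x => (zS 0 x - 2 * zK 0 x) / π := funext Y0_eq
    rw [this]
    have hc : Continuous (zS 0) := continuous_iff_continuousAt.2 fun x => (zS_deriv 0 x).continuousAt
    exact ((hc.intervalIntegrable _ _).sub (hK.const_mul 2)).div_const _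
  refine ⟨hi, ?_⟩
  have hd : ∀ x, 0 < x → HasDerivAt (fun x => -(x * (zK 0 x * zC 1 x + zK 1 x * zS 0 x)) / π) (besselY 0 x) x := by
    intro x hx
    have := ((hasDerivAt_id' x).mul (((zK_deriv 0 hx).mul (zC_deriv 1 x)).add ((zK_deriv 1 hx).mul (zS_deriv 0 x)))).neg.div_const π
    refine this.congr_deriv ?_
    rw [Y0_eq]
    have h1 := zK_ibp hx
    have h2 := zS_ibp x
    have h3 : x * zK 2 x = 1 + zK 1 x - x * zK 0 x := by linarith
    have h4 : x * zS 2 x = x * zS 0 x - 2 + zC 1 x := by linarith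
    simp only [Pi.mul_apply, Pi.add_apply, zero_add, Nat.reduceAdd]
    field_simp
    linear_combination (zS 0 x) * h3 + zK 0 x * h4
  have hx12 : Tendsto (fun x : ℝ => √π * x ^ (1/2 : ℝ)) (𝓝[>] 0) (𝓝 0) := by
    have h := (Real.continuous_rpow_const (q := (1/2 : ℝ)) (by norm_num)).tendsto 0
    rw [Real.zero_rpow (by norm_num)] at h
    simpa using (h.const_mul (√π)).mono_left nhdsWithin_le_nhds
  have hxK : Tendsto (fun x : ℝ => x * zK 0 x) (𝓝[>] 0) (𝓝 0) := by
    refine squeeze_zero_norm' ?_ hx12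
    filter_upwards [self_mem_nhdsWithin] with x (hx : 0 < x)
    have := zK_nonneg 0 x
    rw [Real.norm_of_nonneg (by positivity)]
    calc _ ≤ x * (√π * x ^ (-(1/2) : ℝ)) := by gcongr; exact zK0_le hx
      _ = √π * (x ^ (1:ℝ) * x ^ (-(1/2) : ℝ)) := by rw [Real.rpow_one]; ring
      _ = _ := by rw [← Real.rpow_add hx]; norm_num
  have hhalf : Tendsto (fun x : ℝ => x / 2) (𝓝[>] 0) (𝓝[>] 0) := by
    refine tendsto_nhdsWithin_iff.2 ⟨?_, ?_⟩
    · have : Tendsto (fun x : ℝ => x / 2) (𝓝 0) (𝓝 (0/2)) := (continuous_id.div_const 2).tendsto 0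
      rw [zero_div] at this
      exact this.mono_left nhdsWithin_le_nhds
    · filter_upwards [self_mem_nhdsWithin] with x (hx : 0 < x) using half_pos hx
  have hlim : Tendsto (fun x => -(x * (zK 0 x * zC 1 x + zK 1 x * zS 0 x)) / π) (𝓝[>] 0) (𝓝 0) := by
    have hb := hxK.add ((hxK.comp hhalf).const_mul 4)
    simp only [mul_zero, add_zero, Function.comp] at hb
    refine squeeze_zero_norm' ?_ hb
    filter_upwards [self_mem_nhdsWithin] with x (hx : 0 < x)
    have k0 := zK_nonneg 0 x
    have k1 := zK_nonneg 1 x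
    rw [norm_div, norm_neg, norm_mul, Real.norm_of_nonneg hx.le, Real.norm_of_nonneg Real.pi_pos.le,
      div_le_iff₀ Real.pi_pos]
    calc x * ‖zK 0 x * zC 1 x + zK 1 x * zS 0 x‖ ≤ x * (zK 0 x * π + zK 1 x * (π * x)) := by
          gcongr
          refine (norm_add_le _ _).trans ?_
          rw [norm_mul, norm_mul, Real.norm_of_nonneg k0, Real.norm_of_nonneg k1]
          have := zS0_le x
          rw [abs_of_pos hx] at this
          gcongr
          exact zC1_le x
      _ = (x * zK 0 x + x * (x * zK 1 x)) * π := by ring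
      _ ≤ (x * zK 0 x + x * (2 * zK 0 (x/2))) * π := by
          have := zK1_le hx
          refine mul_le_mul_of_nonneg_right ?_ Real.pi_pos.le
          have := mul_le_mul_of_nonneg_left this hx.le
          linarith
      _ = _ := by ring
  rw [intervalIntegral.integral_eq_sub_of_hasDerivAt_of_tendsto hσ (fun x hx => hd x hx.1) hi hlim
    ((hd σ hσ).continuousAt.tendsto.mono_left nhdsWithin_le_nhds)]
  rw [Y0_eq, Y1_eq, struveHm1_eq, struveH0_eq]
  field_simp
  ring

/-- the improper integral `∫₀^σ H₀⁽¹⁾(x) dx` converges and equals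
`(π/2)·σ·[H₀⁽¹⁾(σ)·𝐇₋₁(σ) + H₁⁽¹⁾(σ)·𝐇₀(σ)]`. -/
theorem statement0 (σ : ℝ) (hσ : 0 < σ) :
    IntervalIntegrable (fun x => hankelH1 0 x) MeasureTheory.volume 0 σ ∧
    ∫ x in (0:ℝ)..σ, hankelH1 0 x
      = (π / 2 : ℝ) * (σ : ℂ) *
          (hankelH1 0 σ * (struveHm1 σ : ℂ) + hankelH1 1 σ * (struveH0 σ : ℂ)) := by
  obtain ⟨hJ, eJ⟩ := J_part σ
  obtain ⟨hY, eY⟩ := Y_part σ hσ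
  have hJ' : IntervalIntegrable (fun x => (besselJ 0 x : ℂ)) volume 0 σ :=
    ⟨hJ.1.ofReal, hJ.2.ofReal⟩
  have hY' : IntervalIntegrable (fun x => Complex.I * (besselY 0 x : ℂ)) volume 0 σ :=
    IntervalIntegrable.const_mul ⟨hY.1.ofReal, hY.2.ofReal⟩ _
  refine ⟨hJ'.add hY', ?_⟩
  simp only [hankelH1]
  rw [intervalIntegral.integral_add hJ' hY', intervalIntegral.integral_const_mul,
    intervalIntegral.integral_ofReal, intervalIntegral.integral_ofReal, eJ, eY]
  push_cast
  ring
end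

section
/- For all reals k, l > 0, define I_γ(x) = (x/l)·(1/k)·[𝓘₀(kx) + 𝓘₀(k(l−x))] + (1/(k²l))·[𝓘₁(k(l−x)) − 𝓘₁(kx)] and I_δ(x) = (x/l)·I_γ(x) for 0 < x < l. Then ∫₀^l I_δ(x) dx = (1/(k²l²))·∫₀^{kl} (l² − (2l/k)·x + (2/k²)·x²)·𝓘₀(x) dx + (π/(2k²))·[H₁⁽¹⁾(kl)·𝐇₀(kl) − H₀⁽¹⁾(kl)·𝐇₁(kl)] − (2/k²)·H₂⁽¹⁾(kl) − 8i/(π k⁴ l²). -/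
open MeasureTheory Set Filter Topology Real intervalIntegral

/-- `𝓘₀(u) = ∫₀^u H₀⁽¹⁾(x) dx`. -/
noncomputable def calI0 (u : ℝ) : ℂ := ∫ x in (0:ℝ)..u, hankelH1 0 x

/-- `𝓘₁(u) = ∫₀^u x·H₀⁽¹⁾(x) dx`. -/
noncomputable def calI1 (u : ℝ) : ℂ := ∫ x in (0:ℝ)..u, (x : ℂ) * hankelH1 0 x

/-- `I_γ(x) = (x/l)·(1/k)·[𝓘₀(kx) + 𝓘₀(k(l−x))] + (1/(k²l))·[𝓘₁(k(l−x)) − 𝓘₁(kx)]`. -/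
noncomputable def Igamma (k l x : ℝ) : ℂ :=
  (x / l : ℝ) * ((1 / k : ℝ) * (calI0 (k * x) + calI0 (k * (l - x))))
    + ((1 / (k ^ 2 * l) : ℝ) : ℂ) * (calI1 (k * (l - x)) - calI1 (k * x))

/-- `I_δ(x) = (x/l)·I_γ(x)`. -/
noncomputable def Idelta (k l x : ℝ) : ℂ := (x / l : ℝ) * Igamma k l x

noncomputable def ggI (b : ℝ) (n : ℕ) (x : ℝ) : ℂ :=
  ∫ τ in (0:ℝ)..b, (Complex.I * (Real.sin τ : ℂ)) ^ n * Complex.exp (x * (Complex.I * (Real.sin τ : ℂ)))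

noncomputable def ssI (n : ℕ) (x : ℝ) : ℝ :=
  ∫ t in Set.Ioi (0:ℝ), (-Real.sinh t) ^ n * Real.exp (x * (-Real.sinh t))

lemma gg_norm (n : ℕ) (x τ : ℝ) :
    ‖(Complex.I * (Real.sin τ : ℂ)) ^ n * Complex.exp (x * (Complex.I * (Real.sin τ : ℂ)))‖ ≤ 1 := by
  have h : (x : ℂ) * (Complex.I * (Real.sin τ : ℂ)) = ((x * Real.sin τ : ℝ) : ℂ) * Complex.I := by
    push_cast; ring
  rw [norm_mul, h, Complex.norm_exp_ofReal_mul_I, mul_one, norm_pow, norm_mul, Complex.norm_I,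
    one_mul, Complex.norm_real]
  exact pow_le_one₀ (norm_nonneg _) (Real.abs_sin_le_one τ)

lemma gg_cont (n : ℕ) (x : ℝ) : Continuous fun τ : ℝ =>
    (Complex.I * (Real.sin τ : ℂ)) ^ n * Complex.exp (x * (Complex.I * (Real.sin τ : ℂ))) := by
  fun_prop

lemma gg_hasDeriv (b : ℝ) (n : ℕ) (x : ℝ) : HasDerivAt (ggI b n) (ggI b (n+1) x) x := by
  have := (intervalIntegral.hasDerivAt_integral_of_dominated_loc_of_deriv_le (𝕜 := ℝ) (μ := volume)
    (a := 0) (b := b) (bound := fun _ => 1) (x₀ := x) (s := Set.univ)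
    (F := fun (x : ℝ) (τ : ℝ) =>
      (Complex.I * (Real.sin τ : ℂ)) ^ n * Complex.exp (x * (Complex.I * (Real.sin τ : ℂ))))
    (F' := fun (x : ℝ) (τ : ℝ) =>
      (Complex.I * (Real.sin τ : ℂ)) ^ (n+1) * Complex.exp (x * (Complex.I * (Real.sin τ : ℂ))))
    Filter.univ_mem (Eventually.of_forall fun y => (gg_cont n y).aestronglyMeasurable)
    ((gg_cont n x).intervalIntegrable _ _) (gg_cont (n+1) x).aestronglyMeasurable
    (Eventually.of_forall fun τ _ y _ => gg_norm (n+1) y τ)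
    (_root_.intervalIntegrable_const) ?_).2
  · exact this
  · refine Eventually.of_forall fun τ _ y _ => ?_
    have h1 : HasDerivAt (fun y : ℝ => (y : ℂ) * (Complex.I * (Real.sin τ : ℂ)))
        (1 * (Complex.I * (Real.sin τ : ℂ))) y :=
      (Complex.ofRealCLM.hasDerivAt (x := y)).mul_const _
    refine HasDerivAt.congr_deriv ((h1.cexp).const_mul ((Complex.I * (Real.sin τ : ℂ)) ^ n)) ?_
    ring

lemma gg_bound (b : ℝ) (n : ℕ) (x : ℝ) : ‖ggI b n x‖ ≤ |b| := by
  have := intervalIntegral.norm_integral_le_of_norm_le_const (a := 0) (b := b) (C := 1)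
    (fun τ _ => gg_norm n x τ)
  simpa [ggI] using this

lemma gg_ode (b x : ℝ) : ggI b 1 x + x * ggI b 0 x + x * ggI b 2 x
    = -Complex.I * (Real.cos b * Complex.exp (x * (Complex.I * (Real.sin b : ℂ))) - 1) := by
  have hd : ∀ τ ∈ Set.uIcc 0 b, HasDerivAt (fun τ : ℝ => -Complex.I * ((Real.cos τ : ℂ) *
      Complex.exp (x * (Complex.I * (Real.sin τ : ℂ)))))
      ((Complex.I * (Real.sin τ : ℂ)) ^ 1 * Complex.exp (x * (Complex.I * (Real.sin τ : ℂ)))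
        + x * ((Complex.I * (Real.sin τ : ℂ)) ^ 0 * Complex.exp (x * (Complex.I * (Real.sin τ : ℂ))))
        + x * ((Complex.I * (Real.sin τ : ℂ)) ^ 2 *
          Complex.exp (x * (Complex.I * (Real.sin τ : ℂ))))) τ := by
    intro τ _
    have hs : HasDerivAt (fun τ : ℝ => (Real.sin τ : ℂ)) (Real.cos τ : ℂ) τ :=
      (Real.hasDerivAt_sin τ).ofReal_comp
    have hc : HasDerivAt (fun τ : ℝ => (Real.cos τ : ℂ)) ((-Real.sin τ : ℝ) : ℂ) τ :=
      (Real.hasDerivAt_cos τ).ofReal_comp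
    refine HasDerivAt.congr_deriv ((hc.mul ((hs.const_mul Complex.I).const_mul (x : ℂ)).cexp).const_mul (-Complex.I)) ?_
    have h2 : (Real.cos τ : ℂ) ^ 2 = 1 - (Real.sin τ : ℂ) ^ 2 := by
      have := Real.sin_sq_add_cos_sq τ
      have h : (Real.cos τ) ^ 2 = 1 - (Real.sin τ) ^ 2 := by linarith
      exact_mod_cast h
    have hI : Complex.I ^ 2 = -1 := Complex.I_sq
    push_cast at h2 ⊢
    generalize Complex.exp _ = e
    linear_combination (-e * x) * hI - (e * x * Complex.I ^ 2) * h2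
  have hint : ∀ n, IntervalIntegrable (fun τ : ℝ => (Complex.I * (Real.sin τ : ℂ)) ^ n *
      Complex.exp (x * (Complex.I * (Real.sin τ : ℂ)))) volume 0 b :=
    fun n => (gg_cont n x).intervalIntegrable _ _
  have := intervalIntegral.integral_eq_sub_of_hasDerivAt hd
    (((hint 1).add ((hint 0).const_mul _)).add ((hint 2).const_mul _))
  rw [intervalIntegral.integral_add ((hint 1).add ((hint 0).const_mul _)) ((hint 2).const_mul _),
    intervalIntegral.integral_add (hint 1) ((hint 0).const_mul _),
    intervalIntegral.integral_const_mul, intervalIntegral.integral_const_mul] at this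
  unfold ggI
  rw [this]
  simp
  ring

lemma sinh_pow_bound (n : ℕ) {x s : ℝ} (hx : 0 < x) (hs : 0 ≤ s) :
    s ^ n * Real.exp (-(x * s)) ≤ (n.factorial * (2 / x) ^ n) * Real.exp (-(x / 2 * s)) := by
  have h := Real.pow_div_factorial_le_exp (x / 2 * s) (by positivity) n
  rw [div_le_iff₀ (by positivity)] at h
  have e : Real.exp (-(x * s)) = Real.exp (-(x / 2 * s)) * Real.exp (-(x / 2 * s)) := by
    rw [← Real.exp_add]; ring_nf
  have e2 : Real.exp (x / 2 * s) * Real.exp (-(x / 2 * s)) = 1 := by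
    rw [← Real.exp_add]; simp
  have e3 : s ^ n = (2 / x) ^ n * (x / 2 * s) ^ n := by
    rw [← mul_pow]; congr 1; field_simp
  calc s ^ n * Real.exp (-(x * s))
      = (2 / x) ^ n * (x / 2 * s) ^ n * (Real.exp (-(x / 2 * s)) * Real.exp (-(x / 2 * s))) := by
        rw [e, e3]
    _ ≤ (2 / x) ^ n * (Real.exp (x / 2 * s) * n.factorial) *
        (Real.exp (-(x / 2 * s)) * Real.exp (-(x / 2 * s))) := by gcongr
    _ = (n.factorial * (2 / x) ^ n) * Real.exp (-(x / 2 * s)) *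
        (Real.exp (x / 2 * s) * Real.exp (-(x / 2 * s))) := by ring
    _ = _ := by rw [e2, mul_one]

lemma ss_norm (n : ℕ) {x y t : ℝ} (hx : 0 < x) (hxy : x ≤ y) (ht : 0 < t) :
    ‖(-Real.sinh t) ^ n * Real.exp (y * (-Real.sinh t))‖
      ≤ (n.factorial * (2 / x) ^ n) * Real.exp (-(x / 2) * t) := by
  have hs : t ≤ Real.sinh t := Real.self_le_sinh_iff.2 ht.le
  have hs0 : 0 ≤ Real.sinh t := ht.le.trans hs
  rw [norm_mul, norm_pow, norm_neg, Real.norm_of_nonneg hs0, Real.norm_of_nonneg (Real.exp_pos _).le]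
  calc _ ≤ Real.sinh t ^ n * Real.exp (-(x * Real.sinh t)) := by
        gcongr; nlinarith
    _ ≤ _ := sinh_pow_bound n hx hs0
    _ ≤ _ := by gcongr; nlinarith

lemma ss_cont (n : ℕ) (x : ℝ) : Continuous fun t : ℝ =>
    (-Real.sinh t) ^ n * Real.exp (x * (-Real.sinh t)) := by
  fun_prop

lemma bd_int (C : ℝ) {x : ℝ} (hx : 0 < x) :
    IntegrableOn (fun t => C * Real.exp (-(x / 2) * t)) (Set.Ioi 0) :=
  (exp_neg_integrableOn_Ioi 0 (by positivity)).const_mul C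

lemma ss_int (n : ℕ) {x : ℝ} (hx : 0 < x) :
    IntegrableOn (fun t : ℝ => (-Real.sinh t) ^ n * Real.exp (x * (-Real.sinh t))) (Set.Ioi 0) := by
  refine Integrable.mono' (bd_int (n.factorial * (2 / x) ^ n) hx)
    (ss_cont n x).aestronglyMeasurable ?_
  exact (ae_restrict_iff' measurableSet_Ioi).2 (Eventually.of_forall fun t ht =>
    ss_norm n hx le_rfl ht)

lemma ss_hasDeriv (n : ℕ) {x : ℝ} (hx : 0 < x) : HasDerivAt (ssI n) (ssI (n+1) x) x := by
  have := (hasDerivAt_integral_of_dominated_loc_of_deriv_le (𝕜 := ℝ) (μ := volume.restrict (Set.Ioi 0))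
    (bound := fun t => ((n+1).factorial * (2 / (x/2)) ^ (n+1)) * Real.exp (-((x/2) / 2) * t))
    (x₀ := x) (s := Set.Ioi (x/2))
    (F := fun (x : ℝ) (t : ℝ) => (-Real.sinh t) ^ n * Real.exp (x * (-Real.sinh t)))
    (F' := fun (x : ℝ) (t : ℝ) => (-Real.sinh t) ^ (n+1) * Real.exp (x * (-Real.sinh t)))
    (Ioi_mem_nhds (by linarith))
    (Eventually.of_forall fun y => (ss_cont n y).aestronglyMeasurable)
    (ss_int n hx) (ss_cont (n+1) x).aestronglyMeasurable
    ((ae_restrict_iff' measurableSet_Ioi).2 (Eventually.of_forall fun t ht y hy =>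
      ss_norm (n+1) (by positivity) (le_of_lt hy) ht))
    (bd_int _ (by positivity)) (Eventually.of_forall fun t y _ => ?_)).2
  · exact this
  · have h1 : HasDerivAt (fun y : ℝ => y * (-Real.sinh t)) (1 * (-Real.sinh t)) y :=
      (hasDerivAt_id y).mul_const _
    refine HasDerivAt.congr_deriv ((h1.exp).const_mul ((-Real.sinh t) ^ n)) ?_
    ring

lemma cosh_exp_tendsto {x : ℝ} (hx : 0 < x) :
    Tendsto (fun t => Real.cosh t * Real.exp (x * (-Real.sinh t))) atTop (𝓝 0) := by
  have hb : Tendsto (fun t : ℝ => (1 + Nat.factorial 1 * (2 / x) ^ 1) * Real.exp (-(x / 2 * t)))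
      atTop (𝓝 0) := by
    rw [← mul_zero (1 + Nat.factorial 1 * (2 / x) ^ 1 : ℝ)]
    refine Tendsto.const_mul _ (Real.tendsto_exp_neg_atTop_nhds_zero.comp ?_)
    exact tendsto_id.const_mul_atTop (by positivity)
  refine squeeze_zero' (Eventually.of_forall fun t => by positivity) ?_ hb
  filter_upwards [eventually_ge_atTop 0] with t ht
  have hs : t ≤ Real.sinh t := Real.self_le_sinh_iff.2 ht
  have hs0 : 0 ≤ Real.sinh t := ht.trans hs
  have hc : Real.cosh t ≤ 1 + Real.sinh t := by
    have := Real.cosh_sub_sinh t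
    have h2 : Real.exp (-t) ≤ 1 := Real.exp_le_one_iff.2 (by linarith)
    linarith
  have h1 := sinh_pow_bound 1 hx hs0
  have h3 : Real.exp (-(x / 2 * Real.sinh t)) ≤ Real.exp (-(x / 2 * t)) := by gcongr
  have h4 : Real.exp (-(x * Real.sinh t)) ≤ Real.exp (-(x / 2 * t)) := by
    gcongr; nlinarith
  calc Real.cosh t * Real.exp (x * (-Real.sinh t))
      ≤ (1 + Real.sinh t) * Real.exp (x * (-Real.sinh t)) := by gcongr
    _ = Real.exp (-(x * Real.sinh t)) + Real.sinh t ^ 1 * Real.exp (-(x * Real.sinh t)) := by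
        rw [mul_neg]; ring
    _ ≤ Real.exp (-(x / 2 * t)) + (Nat.factorial 1 * (2 / x) ^ 1) * Real.exp (-(x / 2 * t)) := by
        refine add_le_add h4 (h1.trans ?_); gcongr
    _ = _ := by ring

lemma ss_ode {x : ℝ} (hx : 0 < x) : ssI 1 x + x * ssI 0 x + x * ssI 2 x = 1 := by
  have hd : ∀ t ∈ Set.Ici (0:ℝ), HasDerivAt (fun t => -(Real.cosh t * Real.exp (x * (-Real.sinh t))))
      ((-Real.sinh t) ^ 1 * Real.exp (x * (-Real.sinh t))
        + x * ((-Real.sinh t) ^ 0 * Real.exp (x * (-Real.sinh t)))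
        + x * ((-Real.sinh t) ^ 2 * Real.exp (x * (-Real.sinh t)))) t := by
    intro t _
    refine HasDerivAt.congr_deriv (((Real.hasDerivAt_cosh t).mul (((Real.hasDerivAt_sinh t).neg).const_mul x).exp).neg) ?_
    have := Real.cosh_sq t
    generalize Real.exp _ = e
    linear_combination (e * x) * this
  have h0 := ss_int 0 hx
  have h1 := ss_int 1 hx
  have h2 := ss_int 2 hx
  have hT := (cosh_exp_tendsto hx).neg
  have := integral_Ioi_of_hasDerivAt_of_tendsto' hd ((h1.add (h0.const_mul x)).add (h2.const_mul x)) hT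
  have h01 := h1.add (h0.const_mul x)
  simp only [Pi.add_def] at h01
  rw [MeasureTheory.integral_add h01 (h2.const_mul x), MeasureTheory.integral_add h1 (h0.const_mul x),
    MeasureTheory.integral_const_mul, MeasureTheory.integral_const_mul] at this
  unfold ssI
  rw [this]; simp

lemma ss_zero_bound {x : ℝ} (hx : 0 < x) : |ssI 0 x| ≤ √(π / (x / 4)) / 2 := by
  have h := integral_gaussian_Ioi (x / 4)
  rw [← h, ← Real.norm_eq_abs]
  refine norm_integral_le_of_norm_le (integrable_exp_neg_mul_sq (by positivity)).integrableOn ?_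
  refine (ae_restrict_iff' measurableSet_Ioi).2 (Eventually.of_forall fun t ht => ?_)
  have ht : 0 < t := ht
  rw [pow_zero, one_mul, Real.norm_of_nonneg (Real.exp_pos _).le]
  apply Real.exp_le_exp.2
  have h1 := Real.quadratic_le_exp_of_nonneg ht.le
  have h2 : Real.exp (-t) ≤ 1 := Real.exp_le_one_iff.2 (by linarith)
  have h3 : t ^ 2 / 4 ≤ Real.sinh t := by rw [Real.sinh_eq]; nlinarith
  have := mul_le_mul_of_nonneg_left h3 hx.le
  linarith

lemma ss_one_bound {x : ℝ} (hx : 0 < x) : |x * ssI 1 x + 1| ≤ x := by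
  have hd : ∀ t ∈ Set.Ici (0:ℝ), HasDerivAt (fun t => -(Real.exp (x * (-Real.sinh t))))
      (x * (Real.cosh t * Real.exp (x * (-Real.sinh t)))) t := by
    intro t _
    refine HasDerivAt.congr_deriv (((((Real.hasDerivAt_sinh t).neg).const_mul x).exp).neg) ?_
    simp only [Pi.neg_apply]; ring
  have hi0 : IntegrableOn (fun t : ℝ => Real.exp (-t) * Real.exp (x * (-Real.sinh t))) (Set.Ioi 0) := by
    have := (bd_int 1 (x := 2) (by norm_num))
    refine Integrable.mono' this (by fun_prop) ?_
    refine (ae_restrict_iff' measurableSet_Ioi).2 (Eventually.of_forall fun t ht => ?_)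
    have ht : 0 < t := ht
    have hs : t ≤ Real.sinh t := Real.self_le_sinh_iff.2 ht.le
    rw [Real.norm_of_nonneg (by positivity), ← Real.exp_add, one_mul]
    gcongr
    nlinarith
  have h1 := ss_int 1 hx
  have e1 : ∀ t : ℝ, Real.cosh t * Real.exp (x * (-Real.sinh t)) =
      Real.exp (-t) * Real.exp (x * (-Real.sinh t)) -
        (-Real.sinh t) ^ 1 * Real.exp (x * (-Real.sinh t)) := by
    intro t; rw [← Real.cosh_sub_sinh]; ring
  have hic : IntegrableOn (fun t : ℝ => Real.cosh t * Real.exp (x * (-Real.sinh t))) (Set.Ioi 0) := by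
    simp_rw [e1]; exact hi0.sub h1
  have hT : Tendsto (fun t => -(Real.exp (x * (-Real.sinh t)))) atTop (𝓝 (-0)) := by
    refine Tendsto.neg (squeeze_zero' (Eventually.of_forall fun t => by positivity) ?_
      (cosh_exp_tendsto hx))
    refine Eventually.of_forall fun t => ?_
    have := Real.one_le_cosh t
    have := Real.exp_pos (x * (-Real.sinh t))
    nlinarith
  have h := integral_Ioi_of_hasDerivAt_of_tendsto' hd (hic.const_mul x) hT
  rw [MeasureTheory.integral_const_mul] at h
  simp_rw [e1] at h
  rw [MeasureTheory.integral_sub hi0 h1] at h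
  have hb : |∫ t in Set.Ioi (0:ℝ), Real.exp (-t) * Real.exp (x * (-Real.sinh t))| ≤ 1 := by
    rw [← Real.norm_eq_abs, ← integral_exp_neg_Ioi_zero]
    refine norm_integral_le_of_norm_le (integrableOn_exp_neg_Ioi 0) ?_
    refine (ae_restrict_iff' measurableSet_Ioi).2 (Eventually.of_forall fun t ht => ?_)
    have ht : 0 < t := ht
    have hs : t ≤ Real.sinh t := Real.self_le_sinh_iff.2 ht.le
    rw [Real.norm_of_nonneg (by positivity), ← Real.exp_add]
    gcongr
    nlinarith
  have : x * ssI 1 x + 1 = x * ∫ t in Set.Ioi (0:ℝ), Real.exp (-t) * Real.exp (x * (-Real.sinh t)) := by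
    unfold ssI
    simp at h ⊢
    linarith
  rw [this, abs_mul, abs_of_pos hx]
  nlinarith

noncomputable def hhI (n : ℕ) (x : ℝ) : ℂ :=
  (1 / π : ℂ) * ggI π n x - (2 * Complex.I / π) * (ssI n x : ℂ)

lemma hh_hasDeriv (n : ℕ) {x : ℝ} (hx : 0 < x) : HasDerivAt (hhI n) (hhI (n+1) x) x :=
  ((gg_hasDeriv π n x).const_mul _).sub ((ss_hasDeriv n hx).ofReal_comp.const_mul _)

lemma hh_ode {x : ℝ} (hx : 0 < x) : hhI 1 x + x * hhI 0 x + x * hhI 2 x = 0 := by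
  have h1 := gg_ode π x
  have h2 : (ssI 1 x : ℂ) + x * ssI 0 x + x * ssI 2 x = 1 := by exact_mod_cast ss_ode hx
  rw [Real.cos_pi, Real.sin_pi] at h1
  simp at h1
  unfold hhI
  linear_combination (1 / π : ℂ) * h1 - (2 * Complex.I / π) * h2

lemma integral_antisymm (f : ℝ → ℂ) (h : ∀ τ, f (π - τ) = - f τ) : ∫ τ in (0:ℝ)..π, f τ = 0 := by
  have h1 := intervalIntegral.integral_comp_sub_left (a := 0) (b := π) f π
  simp only [h, sub_self, sub_zero, intervalIntegral.integral_neg] at h1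
  have : (2 : ℂ) * ∫ τ in (0:ℝ)..π, f τ = 0 := by linear_combination -h1
  simpa using this

lemma bessel_combine (n : ℕ) (x : ℝ) :
    ((∫ τ in (0:ℝ)..π, Real.cos (n * τ - x * Real.sin τ) : ℝ) : ℂ)
      + Complex.I * ((∫ τ in (0:ℝ)..π, Real.sin (x * Real.sin τ - n * τ) : ℝ) : ℂ)
    = ∫ τ in (0:ℝ)..π, (Complex.cos (n * τ) - Complex.I * Complex.sin (n * τ)) *
        Complex.exp (x * (Complex.I * (Real.sin τ : ℂ))) := by
  rw [← intervalIntegral.integral_ofReal, ← intervalIntegral.integral_ofReal,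
    ← intervalIntegral.integral_const_mul, ← intervalIntegral.integral_add]
  · refine intervalIntegral.integral_congr fun τ _ => ?_
    have e1 : Real.cos (n * τ - x * Real.sin τ) = Real.cos (x * Real.sin τ - n * τ) := by
      rw [← Real.cos_neg]; ring_nf
    simp only [e1]
    have e2 : (Complex.cos (n * τ) - Complex.I * Complex.sin (n * τ))
        = Complex.exp ((-(n * τ)) * Complex.I) := by
      rw [Complex.exp_mul_I, Complex.cos_neg, Complex.sin_neg]; ring
    rw [e2, ← Complex.exp_add]
    have e3 : (-(n * τ : ℂ)) * Complex.I + x * (Complex.I * (Real.sin τ : ℂ))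
        = ((x * Real.sin τ - n * τ : ℝ) : ℂ) * Complex.I := by push_cast; ring
    rw [e3, Complex.exp_mul_I]
    push_cast; ring
  · exact Continuous.intervalIntegrable (by fun_prop) _ _
  · exact Continuous.intervalIntegrable (by fun_prop) _ _

lemma hankel_eq (n : ℕ) (x : ℝ) : hankelH1 n x = (1 / π : ℂ) *
      (∫ τ in (0:ℝ)..π, (Complex.cos (n * τ) - Complex.I * Complex.sin (n * τ)) *
        Complex.exp (x * (Complex.I * (Real.sin τ : ℂ))))
      - (Complex.I / π) * ((∫ t in Set.Ioi (0:ℝ),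
        (Real.exp (n * t) + (-1 : ℝ) ^ n * Real.exp (-(n * t))) * Real.exp (-x * Real.sinh t) : ℝ) : ℂ) := by
  rw [← bessel_combine]
  unfold hankelH1 besselJ besselY
  push_cast
  ring

lemma hankel_zero (x : ℝ) : hankelH1 0 x = hhI 0 x := by
  rw [hankel_eq]
  unfold hhI ggI ssI
  have : ∀ t : ℝ, (Real.exp ((0:ℕ) * t) + (-1 : ℝ) ^ 0 * Real.exp (-((0:ℕ) * t))) *
      Real.exp (-x * Real.sinh t) = 2 * ((-Real.sinh t) ^ 0 * Real.exp (x * (-Real.sinh t))) := by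
    intro t
    simp; norm_num
  simp_rw [this]
  rw [MeasureTheory.integral_const_mul]
  simp
  ring

lemma hankel_one (x : ℝ) : hankelH1 1 x = - hhI 1 x := by
  rw [hankel_eq]
  unfold hhI ssI
  have : ∀ t : ℝ, (Real.exp ((1:ℕ) * t) + (-1 : ℝ) ^ 1 * Real.exp (-((1:ℕ) * t))) *
      Real.exp (-x * Real.sinh t) = (-2) * ((-Real.sinh t) ^ 1 * Real.exp (x * (-Real.sinh t))) := by
    intro t
    have h : -x * Real.sinh t = x * (-Real.sinh t) := by ring
    rw [h]
    generalize Real.exp (x * (-Real.sinh t)) = e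
    rw [Real.sinh_eq]
    simp; ring
  simp_rw [this]
  rw [MeasureTheory.integral_const_mul]
  have h2 : (∫ τ in (0:ℝ)..π, (Complex.cos ((1:ℕ) * τ) - Complex.I * Complex.sin ((1:ℕ) * τ)) *
        Complex.exp (x * (Complex.I * (Real.sin τ : ℂ)))) = - ggI π 1 x := by
    have h3 := integral_antisymm (fun τ => Complex.cos τ *
        Complex.exp (x * (Complex.I * (Real.sin τ : ℂ)))) (fun τ => by
          simp [Complex.cos_pi_sub, Complex.sin_pi_sub])
    have h4 : - ggI π 1 x = (∫ τ in (0:ℝ)..π, Complex.cos τ *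
        Complex.exp (x * (Complex.I * (Real.sin τ : ℂ)))) - ggI π 1 x := by rw [h3]; ring
    rw [h4]
    unfold ggI
    rw [← intervalIntegral.integral_sub]
    · refine intervalIntegral.integral_congr fun τ _ => ?_
      simp; ring
    · exact Continuous.intervalIntegrable (by fun_prop) _ _
    · exact (gg_cont 1 x).intervalIntegrable _ _
  rw [h2]
  push_cast
  ring

lemma hankel_two {x : ℝ} (hx : 0 < x) : hankelH1 2 x = hhI 0 x + 2 * hhI 2 x := by
  rw [hankel_eq]
  unfold hhI
  have : ∀ t : ℝ, (Real.exp ((2:ℕ) * t) + (-1 : ℝ) ^ 2 * Real.exp (-((2:ℕ) * t))) *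
      Real.exp (-x * Real.sinh t) = 2 * ((-Real.sinh t) ^ 0 * Real.exp (x * (-Real.sinh t)))
        + 4 * ((-Real.sinh t) ^ 2 * Real.exp (x * (-Real.sinh t))) := by
    intro t
    have h : -x * Real.sinh t = x * (-Real.sinh t) := by ring
    rw [h]
    generalize Real.exp (x * (-Real.sinh t)) = e
    have h5 : Real.exp ((2:ℕ) * t) + (-1 : ℝ) ^ 2 * Real.exp (-((2:ℕ) * t)) = 2 * Real.cosh (2 * t) := by
      rw [Real.cosh_eq]; push_cast; ring
    rw [h5, Real.cosh_two_mul, Real.cosh_sq]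
    ring
  simp_rw [this]
  rw [MeasureTheory.integral_add ((ss_int 0 hx).const_mul _) ((ss_int 2 hx).const_mul _),
    MeasureTheory.integral_const_mul, MeasureTheory.integral_const_mul]
  have h2 : (∫ τ in (0:ℝ)..π, (Complex.cos ((2:ℕ) * τ) - Complex.I * Complex.sin ((2:ℕ) * τ)) *
        Complex.exp (x * (Complex.I * (Real.sin τ : ℂ)))) = ggI π 0 x + 2 * ggI π 2 x := by
    have h3 := integral_antisymm (fun τ => -Complex.I * (2 * Complex.sin τ * Complex.cos τ) *
        Complex.exp (x * (Complex.I * (Real.sin τ : ℂ)))) (fun τ => by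
          simp [Complex.cos_pi_sub, Complex.sin_pi_sub])
    have h4 : ggI π 0 x + 2 * ggI π 2 x = (∫ τ in (0:ℝ)..π, -Complex.I *
        (2 * Complex.sin τ * Complex.cos τ) *
        Complex.exp (x * (Complex.I * (Real.sin τ : ℂ)))) + (ggI π 0 x + 2 * ggI π 2 x) := by
      rw [h3]; ring
    rw [h4]
    unfold ggI
    rw [← intervalIntegral.integral_const_mul, ← intervalIntegral.integral_add,
      ← intervalIntegral.integral_add]
    · refine intervalIntegral.integral_congr fun τ _ => ?_
      simp only [Nat.cast_ofNat]
      rw [Complex.cos_two_mul, Complex.sin_two_mul]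
      have h6 : Complex.cos τ ^ 2 = 1 - Complex.sin τ ^ 2 := by
        rw [← Complex.sin_sq_add_cos_sq τ]; ring
      push_cast
      generalize Complex.exp _ = e
      linear_combination 2 * e * h6 - 2 * e * Complex.sin τ ^ 2 * Complex.I_sq
    · exact Continuous.intervalIntegrable (by fun_prop) _ _
    · exact Continuous.intervalIntegrable (by fun_prop) _ _
    · exact Continuous.intervalIntegrable (by fun_prop) _ _
    · exact Continuous.intervalIntegrable (by fun_prop) _ _
  rw [h2]
  unfold ssI
  push_cast
  ring

lemma sin_image : Real.sin '' Set.Ioo 0 (π / 2) = Set.Ioo 0 1 := by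
  ext t
  constructor
  · rintro ⟨θ, ⟨h0, h1⟩, rfl⟩
    refine ⟨Real.sin_pos_of_pos_of_lt_pi h0 (by linarith [Real.pi_pos]), ?_⟩
    have := Real.sin_lt_sin_of_lt_of_le_pi_div_two (x := θ) (y := π/2) (by linarith) le_rfl h1
    simpa using this
  · rintro ⟨h0, h1⟩
    exact ⟨Real.arcsin t, ⟨Real.arcsin_pos.2 h0, Real.arcsin_lt_pi_div_two.2 h1⟩,
      Real.sin_arcsin (by linarith) h1.le⟩

lemma subst_sin (f : ℝ → ℝ) : ∫ t in (0:ℝ)..1, f t =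
    ∫ θ in (0:ℝ)..(π/2), Real.cos θ * f (Real.sin θ) := by
  have hpi := Real.pi_pos
  have hinj : Set.InjOn Real.sin (Set.Ioo 0 (π / 2)) :=
    by
    refine Set.InjOn.mono ?_ Real.injOn_sin
    intro θ h
    exact ⟨by linarith [h.1], h.2.le⟩
  rw [intervalIntegral.integral_of_le zero_le_one, intervalIntegral.integral_of_le (by positivity),
    integral_Ioc_eq_integral_Ioo, integral_Ioc_eq_integral_Ioo, ← sin_image,
    integral_image_eq_integral_abs_deriv_smul measurableSet_Ioo (f' := Real.cos)
      (fun θ _ => (Real.hasDerivAt_sin θ).hasDerivWithinAt) hinj]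
  refine setIntegral_congr_fun measurableSet_Ioo fun θ h => ?_
  have : 0 ≤ Real.cos θ := Real.cos_nonneg_of_mem_Icc ⟨by linarith [h.1], h.2.le⟩
  simp [abs_of_nonneg this]

lemma gg_im (b : ℝ) (x : ℝ) : (ggI b 0 x).im = ∫ θ in (0:ℝ)..b, Real.sin (x * Real.sin θ) := by
  have := (Complex.imCLM.intervalIntegral_comp_comm ((gg_cont 0 x).intervalIntegrable (μ := volume) 0 b))
  unfold ggI
  rw [← Complex.imCLM_apply, ← this]
  refine intervalIntegral.integral_congr fun τ _ => ?_
  have h : (x : ℂ) * (Complex.I * (Real.sin τ : ℂ)) = ((x * Real.sin τ : ℝ) : ℂ) * Complex.I := by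
    push_cast; ring
  simp only [h, pow_zero, one_mul, Complex.imCLM_apply, Complex.exp_ofReal_mul_I_im]

lemma gg_im2 (b : ℝ) (x : ℝ) : (ggI b 2 x).im =
    ∫ θ in (0:ℝ)..b, - Real.sin θ ^ 2 * Real.sin (x * Real.sin θ) := by
  have := (Complex.imCLM.intervalIntegral_comp_comm ((gg_cont 2 x).intervalIntegrable (μ := volume) 0 b))
  unfold ggI
  rw [← Complex.imCLM_apply, ← this]
  refine intervalIntegral.integral_congr fun τ _ => ?_
  have h : (x : ℂ) * (Complex.I * (Real.sin τ : ℂ)) = ((x * Real.sin τ : ℝ) : ℂ) * Complex.I := by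
    push_cast; ring
  have h2 : (Complex.I * (Real.sin τ : ℂ)) ^ 2 = ((- Real.sin τ ^ 2 : ℝ) : ℂ) := by
    rw [mul_pow, Complex.I_sq]; push_cast; ring
  simp only [h, h2, Complex.imCLM_apply, Complex.im_ofReal_mul, Complex.exp_ofReal_mul_I_im]

lemma struve0_eq (x : ℝ) : struveH0 x = (2 / π) * (ggI (π/2) 0 x).im := by
  unfold struveH0
  rw [gg_im, subst_sin]
  congr 1
  have hpi := Real.pi_pos
  rw [intervalIntegral.integral_of_le (by positivity), intervalIntegral.integral_of_le (by positivity),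
    integral_Ioc_eq_integral_Ioo, integral_Ioc_eq_integral_Ioo]
  refine setIntegral_congr_fun measurableSet_Ioo fun θ h => ?_
  have h0 : 0 < Real.cos θ := Real.cos_pos_of_mem_Ioo ⟨by linarith [h.1], h.2⟩
  have h1 : √(1 - Real.sin θ ^ 2) = Real.cos θ := by
    rw [← Real.cos_sq', Real.sqrt_sq h0.le]
  simp only [h1]
  field_simp

lemma struve1_eq (x : ℝ) : struveH1 x = (2 / π) * (1 - (ggI (π/2) 1 x).im) := by
  have ho := congrArg Complex.im (gg_ode (π/2) x)
  simp [Complex.im_ofReal_mul] at ho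
  have h3 : (∫ t in (0:ℝ)..1, Real.sqrt (1 - t ^ 2) * Real.sin (x * t))
      = (ggI (π/2) 0 x).im + (ggI (π/2) 2 x).im := by
    have hpi := Real.pi_pos
    rw [gg_im, gg_im2, subst_sin, ← intervalIntegral.integral_add]
    · rw [intervalIntegral.integral_of_le (by positivity),
        intervalIntegral.integral_of_le (by positivity),
        integral_Ioc_eq_integral_Ioo, integral_Ioc_eq_integral_Ioo]
      refine setIntegral_congr_fun measurableSet_Ioo fun θ h => ?_
      have h0 : 0 < Real.cos θ := Real.cos_pos_of_mem_Ioo ⟨by linarith [h.1], h.2⟩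
      have h1 : √(1 - Real.sin θ ^ 2) = Real.cos θ := by
        rw [← Real.cos_sq', Real.sqrt_sq h0.le]
      simp only [h1]
      have := Real.cos_sq' θ
      linear_combination Real.sin (x * Real.sin θ) * this
    · exact Continuous.intervalIntegrable (by fun_prop) _ _
    · exact Continuous.intervalIntegrable (by fun_prop) _ _
  unfold struveH1
  rw [h3]
  linear_combination (2 / π) * ho

lemma im_deriv {f : ℝ → ℂ} {f' : ℂ} {x : ℝ} (h : HasDerivAt f f' x) :
    HasDerivAt (fun x => (f x).im) f'.im x :=
  (Complex.imCLM.hasFDerivAt.comp_hasDerivAt x h)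

lemma struve0_deriv (x : ℝ) : HasDerivAt struveH0 (2 / π - struveH1 x) x := by
  have h := (im_deriv (gg_hasDeriv (π/2) 0 x)).const_mul (2 / π)
  have e : struveH0 = fun x => (2 / π) * (ggI (π/2) 0 x).im := funext struve0_eq
  rw [e, struve1_eq]
  exact h.congr_deriv (by ring)

lemma struve1_deriv {x : ℝ} (hx : 0 < x) : HasDerivAt struveH1 (struveH0 x - struveH1 x / x) x := by
  have h := ((im_deriv (gg_hasDeriv (π/2) 1 x)).const_sub 1).const_mul (2 / π)
  have e : struveH1 = fun x => (2 / π) * (1 - (ggI (π/2) 1 x).im) := funext struve1_eq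
  have ho := congrArg Complex.im (gg_ode (π/2) x)
  simp [Complex.im_ofReal_mul] at ho
  rw [e, struve0_eq]
  refine h.congr_deriv ?_
  have hpi := Real.pi_pos
  field_simp
  norm_num
  linear_combination -ho

lemma H0_deriv {x : ℝ} (hx : 0 < x) : HasDerivAt (hankelH1 0) (-hankelH1 1 x) x := by
  have e : hankelH1 0 = hhI 0 := funext hankel_zero
  rw [e, hankel_one, neg_neg]
  exact hh_hasDeriv 0 hx

lemma H1_deriv {x : ℝ} (hx : 0 < x) :
    HasDerivAt (hankelH1 1) (hankelH1 0 x - hankelH1 1 x / x) x := by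
  have e : hankelH1 1 = fun x => -hhI 1 x := funext hankel_one
  rw [e, hankel_zero]
  refine (hh_hasDeriv 1 hx).neg.congr_deriv ?_
  have h := hh_ode hx
  have hx' : (x : ℂ) ≠ 0 := by exact_mod_cast hx.ne'
  field_simp
  linear_combination -h

lemma H2_eq {x : ℝ} (hx : 0 < x) : x * hankelH1 2 x = 2 * hankelH1 1 x - x * hankelH1 0 x := by
  rw [hankel_two hx, hankel_one, hankel_zero]
  linear_combination 2 * hh_ode hx

lemma xH0_deriv {x : ℝ} (hx : 0 < x) :
    HasDerivAt (fun x : ℝ => (x : ℂ) * hankelH1 0 x) (hankelH1 0 x - x * hankelH1 1 x) x := by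
  have h := (Complex.ofRealCLM.hasDerivAt (x := x)).mul (H0_deriv hx)
  refine h.congr_deriv ?_
  simp; ring

lemma xH1_deriv {x : ℝ} (hx : 0 < x) :
    HasDerivAt (fun x : ℝ => (x : ℂ) * hankelH1 1 x) (x * hankelH1 0 x) x := by
  have h := (Complex.ofRealCLM.hasDerivAt (x := x)).mul (H1_deriv hx)
  refine h.congr_deriv ?_
  have hx' : (x : ℂ) ≠ 0 := by exact_mod_cast hx.ne'
  simp
  field_simp
  ring

lemma H0_bound : ∃ C : ℝ, ∀ x : ℝ, 0 < x → ‖hankelH1 0 x‖ ≤ 1 + C * x ^ (-(1/2) : ℝ) := by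
  refine ⟨2 / π * (√(4 * π) / 2), fun x hx => ?_⟩
  have hpi := Real.pi_pos
  rw [hankel_zero]
  have h1 := gg_bound π 0 x
  have h2 := ss_zero_bound hx
  rw [abs_of_pos hpi] at h1
  have h3 : √(π / (x / 4)) = √(4 * π) * x ^ (-(1/2) : ℝ) := by
    rw [Real.rpow_neg hx.le, ← Real.sqrt_eq_rpow, ← Real.sqrt_inv, ← Real.sqrt_mul (by positivity)]
    congr 1; field_simp
  rw [h3] at h2
  unfold hhI
  refine (norm_sub_le _ _).trans ?_
  rw [norm_mul, norm_mul, Complex.norm_real, Real.norm_eq_abs]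
  have n1 : ‖(1 / π : ℂ)‖ = 1 / π := by simp [abs_of_pos hpi]
  have n2 : ‖(2 * Complex.I / π : ℂ)‖ = 2 / π := by simp [abs_of_pos hpi]
  rw [n1, n2]
  refine add_le_add ?_ ?_
  · calc 1 / π * ‖ggI π 0 x‖ ≤ 1 / π * π := by gcongr
      _ = 1 := by field_simp
  · calc 2 / π * |ssI 0 x| ≤ 2 / π * (√(4 * π) * x ^ (-(1/2) : ℝ) / 2) := by gcongr
      _ = _ := by ring

lemma H0_cont : ContinuousOn (hankelH1 0) (Set.Ioi 0) := fun _ hx =>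
  (H0_deriv hx).continuousAt.continuousWithinAt

lemma H0_int {a : ℝ} (ha : 0 ≤ a) : IntervalIntegrable (hankelH1 0) volume 0 a := by
  obtain ⟨C, hC⟩ := H0_bound
  have hb : IntervalIntegrable (fun x : ℝ => 1 + C * x ^ (-(1/2) : ℝ)) volume 0 a :=
    (_root_.intervalIntegrable_const).add
      ((intervalIntegral.intervalIntegrable_rpow' (by norm_num)).const_mul C)
  refine hb.mono_fun' ?_ ?_
  · rw [uIoc_of_le ha]
    exact (H0_cont.mono fun x hx => hx.1).aestronglyMeasurable measurableSet_Ioc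
  · rw [uIoc_of_le ha]
    exact (ae_restrict_iff' measurableSet_Ioc).2 (Eventually.of_forall fun t ht => hC t ht.1)

lemma xH0_tendsto : Tendsto (fun x : ℝ => (x : ℂ) * hankelH1 0 x) (𝓝[>] 0) (𝓝 0) := by
  obtain ⟨C, hC⟩ := H0_bound
  have hb : Tendsto (fun x : ℝ => x + C * x ^ ((1/2) : ℝ)) (𝓝[>] 0) (𝓝 0) := by
    have : Continuous (fun x : ℝ => x + C * x ^ ((1/2) : ℝ)) := by
      have := Real.continuous_rpow_const (q := 1/2) (by norm_num)
      fun_prop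
    have h := (this.tendsto 0).mono_left (nhdsWithin_le_nhds (s := Set.Ioi 0))
    simpa using h
  refine squeeze_zero_norm' ?_ hb
  filter_upwards [self_mem_nhdsWithin] with x hx
  have hx : 0 < x := hx
  rw [norm_mul, Complex.norm_real, Real.norm_of_nonneg hx.le]
  have e : x ^ ((1/2) : ℝ) = x * x ^ (-(1/2) : ℝ) := by
    nth_rewrite 2 [← Real.rpow_one x]
    rw [← Real.rpow_add hx]; norm_num
  rw [e]
  have := mul_le_mul_of_nonneg_left (hC x hx) hx.le
  linarith

lemma xH1_tendsto : Tendsto (fun x : ℝ => (x : ℂ) * hankelH1 1 x) (𝓝[>] 0)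
    (𝓝 (-(2 * Complex.I / π))) := by
  have hpi := Real.pi_pos
  rw [tendsto_iff_norm_sub_tendsto_zero]
  have hb : Tendsto (fun x : ℝ => x * (1 + 2 / π)) (𝓝[>] 0) (𝓝 0) := by
    have : Continuous (fun x : ℝ => x * (1 + 2 / π)) := by fun_prop
    have h := (this.tendsto 0).mono_left (nhdsWithin_le_nhds (s := Set.Ioi 0))
    simpa using h
  refine squeeze_zero' (Eventually.of_forall fun x => norm_nonneg _) ?_ hb
  filter_upwards [self_mem_nhdsWithin] with x hx
  have hx : 0 < x := hx
  have h1 := gg_bound π 1 x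
  have h2 := ss_one_bound hx
  rw [abs_of_pos hpi] at h1
  have e : (x : ℂ) * hankelH1 1 x - -(2 * Complex.I / π)
      = -((1 / π : ℂ) * (x * ggI π 1 x)) + (2 * Complex.I / π) * ((x * ssI 1 x + 1 : ℝ) : ℂ) := by
    rw [hankel_one]; unfold hhI; push_cast; ring
  rw [e]
  refine (norm_add_le _ _).trans ?_
  rw [norm_neg, norm_mul, norm_mul, norm_mul, Complex.norm_real, Complex.norm_real, Real.norm_eq_abs,
    Real.norm_eq_abs, abs_of_pos hx]
  have n1 : ‖(1 / π : ℂ)‖ = 1 / π := by simp [abs_of_pos hpi]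
  have n2 : ‖(2 * Complex.I / π : ℂ)‖ = 2 / π := by simp [abs_of_pos hpi]
  rw [n1, n2]
  calc _ ≤ 1 / π * (x * π) + 2 / π * x := by gcongr
    _ = _ := by field_simp

lemma int_of_tendsto {f : ℝ → ℂ} {c : ℂ} {a : ℝ} (ha : 0 ≤ a) (hf : ContinuousOn f (Set.Ioi 0))
    (hT : Tendsto f (𝓝[>] 0) (𝓝 c)) : IntervalIntegrable f volume 0 a := by
  have hc : ContinuousOn (Function.update f 0 c) (Set.Icc 0 a) := by
    rw [continuousOn_update_iff]
    refine ⟨hf.mono fun x hx => lt_of_le_of_ne hx.1.1 (Ne.symm hx.2), fun _ => ?_⟩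
    exact hT.mono_left (nhdsWithin_mono _ fun x hx => lt_of_le_of_ne hx.1.1 (Ne.symm hx.2))
  have h1 : IntervalIntegrable (Function.update f 0 c) volume 0 a := by
    apply ContinuousOn.intervalIntegrable
    rwa [uIcc_of_le ha]
  refine h1.congr ?_
  rw [uIoc_of_le ha]
  intro x hx
  exact Function.update_of_ne hx.1.ne' _ _

lemma calI1_eq {u : ℝ} (hu : 0 < u) : calI1 u = u * hankelH1 1 u + 2 * Complex.I / π := by
  unfold calI1
  have hcont : ContinuousOn (fun x : ℝ => (x : ℂ) * hankelH1 0 x) (Set.Ioi 0) := fun x hx =>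
    (xH0_deriv hx).continuousAt.continuousWithinAt
  rw [intervalIntegral.integral_eq_sub_of_hasDerivAt_of_tendsto hu
    (fun x hx => xH1_deriv hx.1) (int_of_tendsto hu.le hcont xH0_tendsto) xH1_tendsto
    ((xH1_deriv hu).continuousAt.tendsto.mono_left nhdsWithin_le_nhds)]
  ring

lemma key {a : ℝ} (ha : 0 < a) : ∫ u in (0:ℝ)..a, ((a - 2 * u : ℝ) : ℂ) * calI1 u
    = (π / 2) * a ^ 2 * (hankelH1 1 a * (struveH0 a : ℂ) - hankelH1 0 a * (struveH1 a : ℂ))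
      - 2 * a ^ 2 * hankelH1 2 a - 8 * Complex.I / π := by
  have hpi : (π : ℂ) ≠ 0 := by exact_mod_cast Real.pi_ne_zero
  have e : ∫ u in (0:ℝ)..a, ((a - 2 * u : ℝ) : ℂ) * calI1 u =
      ∫ u in (0:ℝ)..a, ((a - 2 * u : ℝ) : ℂ) * (u * hankelH1 1 u + 2 * Complex.I / π) := by
    rw [intervalIntegral.integral_of_le ha.le, intervalIntegral.integral_of_le ha.le]
    refine setIntegral_congr_fun measurableSet_Ioc fun u hu => ?_
    simp only [calI1_eq hu.1]
  rw [e]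
  let Φ : ℝ → ℂ := fun u => a * (π / 2) * ((u * hankelH1 1 u) * (struveH0 u : ℂ)
      - (u * hankelH1 0 u) * (struveH1 u : ℂ)) + (2 * Complex.I / π) * a * u
      - 2 * (2 * (u * hankelH1 1 u) - u * (u * hankelH1 0 u)) - (2 * Complex.I / π) * (u * u)
  have hid : ∀ u : ℝ, HasDerivAt (fun u : ℝ => (u : ℂ)) 1 u := fun u =>
    HasDerivAt.congr_deriv (Complex.ofRealCLM.hasDerivAt (x := u)) (by simp)
  have hΦ : ∀ u : ℝ, 0 < u → HasDerivAt Φ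
      (((a - 2 * u : ℝ) : ℂ) * (u * hankelH1 1 u + 2 * Complex.I / π)) u := by
    intro u hu
    have hs0 := (struve0_deriv u).ofReal_comp
    have hs1 := (struve1_deriv hu).ofReal_comp
    have hp := xH1_deriv hu
    have hq := xH0_deriv hu
    have hi := hid u
    refine HasDerivAt.congr_deriv ((((((hp.mul hs0).sub (hq.mul hs1)).const_mul
      ((a : ℂ) * (π / 2))).add (hi.const_mul ((2 * Complex.I / π) * a))).sub
      (((hp.const_mul 2).sub (hi.mul hq)).const_mul 2)).sub
      ((hi.mul hi).const_mul (2 * Complex.I / π))) ?_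
    have hu' : (u : ℂ) ≠ 0 := by exact_mod_cast hu.ne'
    push_cast
    field_simp
    ring
  have hpc : ContinuousOn (fun u : ℝ => ((a - 2 * u : ℝ) : ℂ) * (u * hankelH1 1 u + 2 * Complex.I / π))
      (Set.Ioi 0) := by
    have : ContinuousOn (fun x : ℝ => (x : ℂ) * hankelH1 1 x) (Set.Ioi 0) := fun x hx =>
      (xH1_deriv hx).continuousAt.continuousWithinAt
    exact ContinuousOn.mul (by fun_prop) (this.add continuousOn_const)
  have hu0 : Tendsto (fun u : ℝ => (u : ℂ)) (𝓝[>] 0) (𝓝 0) := by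
    have := (Complex.continuous_ofReal.tendsto 0).mono_left (nhdsWithin_le_nhds (s := Set.Ioi 0))
    simpa using this
  have hpT : Tendsto (fun u : ℝ => ((a - 2 * u : ℝ) : ℂ) * (u * hankelH1 1 u + 2 * Complex.I / π))
      (𝓝[>] 0) (𝓝 ((a - 2 * 0) * (-(2 * Complex.I / π) + 2 * Complex.I / π))) := by
    push_cast
    exact (tendsto_const_nhds.sub (hu0.const_mul 2)).mul (xH1_tendsto.add tendsto_const_nhds)
  have hs0 : Tendsto (fun u => (struveH0 u : ℂ)) (𝓝[>] 0) (𝓝 ((struveH0 0 : ℝ) : ℂ)) :=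
    ((struve0_deriv 0).ofReal_comp).continuousAt.tendsto.mono_left nhdsWithin_le_nhds
  have hs1 : Tendsto (fun u => (struveH1 u : ℂ)) (𝓝[>] 0) (𝓝 ((struveH1 0 : ℝ) : ℂ)) := by
    have h := ((im_deriv (gg_hasDeriv (π/2) 1 0)).const_sub 1).const_mul (2 / π)
    have e : struveH1 = fun x => (2 / π) * (1 - (ggI (π/2) 1 x).im) := funext struve1_eq
    rw [e]
    exact (h.ofReal_comp).continuousAt.tendsto.mono_left nhdsWithin_le_nhds
  have hz : struveH0 0 = 0 := by simp [struveH0]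
  have hΦ0 := (((((xH1_tendsto.mul hs0).sub (xH0_tendsto.mul hs1)).const_mul
      ((a : ℂ) * (π / 2))).add (hu0.const_mul ((2 * Complex.I / π) * a))).sub
      (((xH1_tendsto.const_mul 2).sub (hu0.mul xH0_tendsto)).const_mul 2)).sub
      ((hu0.mul hu0).const_mul (2 * Complex.I / π))
  rw [intervalIntegral.integral_eq_sub_of_hasDerivAt_of_tendsto ha
    (fun x hx => hΦ x hx.1) (int_of_tendsto ha.le hpc hpT) hΦ0
    ((hΦ a ha).continuousAt.tendsto.mono_left nhdsWithin_le_nhds)]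
  simp only [Φ, hz]
  have h2 := H2_eq ha
  push_cast
  linear_combination (2 * a : ℂ) * h2

lemma calI0_cont {a : ℝ} (ha : 0 ≤ a) : ContinuousOn calI0 (Set.Icc 0 a) := by
  have h := H0_int ha
  rw [intervalIntegrable_iff_integrableOn_Icc_of_le ha] at h
  have := intervalIntegral.continuousOn_primitive_interval (a := 0) (b := a) (f := hankelH1 0)
    (μ := volume) (by rwa [uIcc_of_le ha])
  rwa [uIcc_of_le ha] at this

lemma calI1_cont {a : ℝ} (ha : 0 ≤ a) : ContinuousOn calI1 (Set.Icc 0 a) := by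
  have hcont : ContinuousOn (fun x : ℝ => (x : ℂ) * hankelH1 0 x) (Set.Ioi 0) := fun x hx =>
    (xH0_deriv hx).continuousAt.continuousWithinAt
  have h := int_of_tendsto ha hcont xH0_tendsto
  rw [intervalIntegrable_iff_integrableOn_Icc_of_le ha] at h
  have := intervalIntegral.continuousOn_primitive_interval (a := 0) (b := a)
    (μ := volume) (f := fun x : ℝ => (x : ℂ) * hankelH1 0 x) (by rwa [uIcc_of_le ha])
  rwa [uIcc_of_le ha] at this

lemma reduce {a : ℝ} (ha : 0 ≤ a) (f g : ℝ → ℂ) (hf : ContinuousOn f (Set.Icc 0 a))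
    (hg : ContinuousOn g (Set.Icc 0 a)) :
    ∫ u in (0:ℝ)..a, ((u : ℂ) ^ 2 * (f u + f (a - u)) + u * (g (a - u) - g u))
     = (∫ u in (0:ℝ)..a, ((a : ℂ) ^ 2 - 2 * a * u + 2 * u ^ 2) * f u)
       + ∫ u in (0:ℝ)..a, ((a - 2 * u : ℝ) : ℂ) * g u := by
  have hm : MapsTo (fun u : ℝ => a - u) (Set.Icc 0 a) (Set.Icc 0 a) := fun u hu =>
    ⟨by linarith [hu.2], by linarith [hu.1]⟩
  have hf' : ContinuousOn (fun u => f (a - u)) (Set.Icc 0 a) := hf.comp (by fun_prop) hm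
  have hg' : ContinuousOn (fun u => g (a - u)) (Set.Icc 0 a) := hg.comp (by fun_prop) hm
  have hi : ∀ F : ℝ → ℂ, ContinuousOn F (Set.Icc 0 a) → IntervalIntegrable F volume 0 a := by
    intro F hF; apply ContinuousOn.intervalIntegrable; rwa [uIcc_of_le ha]
  have hr := intervalIntegral.integral_comp_sub_left (a := 0) (b := a)
    (fun u : ℝ => ((a - u : ℝ) : ℂ) ^ 2 * f u + ((a - u : ℝ) : ℂ) * g u) a
  simp only [sub_self, sub_zero, sub_sub_cancel] at hr
  have h1 : ∫ u in (0:ℝ)..a, ((u : ℂ) ^ 2 * (f u + f (a - u)) + u * (g (a - u) - g u))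
      = (∫ u in (0:ℝ)..a, ((u : ℂ) ^ 2 * f u - u * g u))
        + ∫ u in (0:ℝ)..a, ((u : ℂ) ^ 2 * f (a - u) + u * g (a - u)) := by
    rw [← intervalIntegral.integral_add (hi _ (by fun_prop)) (hi _ (by fun_prop))]
    exact intervalIntegral.integral_congr fun u _ => by ring
  rw [h1, hr, ← intervalIntegral.integral_add (hi _ (by fun_prop)) (hi _ (by fun_prop)),
    ← intervalIntegral.integral_add (hi _ (by fun_prop)) (hi _ (by fun_prop))]
  exact intervalIntegral.integral_congr fun u _ => by push_cast; ring


theorem statement11 (k l : ℝ) (hk : 0 < k) (hl : 0 < l) :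
    ∫ x in (0:ℝ)..l, Idelta k l x
      = (1 / ((k : ℂ) ^ 2 * (l : ℂ) ^ 2)) *
          (∫ x in (0:ℝ)..(k * l),
            ((l ^ 2 - (2 * l / k) * x + (2 / k ^ 2) * x ^ 2 : ℝ) : ℂ) * calI0 x)
        + ((π / (2 * k ^ 2) : ℝ) : ℂ) *
            (hankelH1 1 (k * l) * (struveH0 (k * l) : ℂ)
              - hankelH1 0 (k * l) * (struveH1 (k * l) : ℂ))
        - (2 / (k : ℂ) ^ 2) * hankelH1 2 (k * l)
        - 8 * Complex.I / ((π : ℂ) * (k : ℂ) ^ 4 * (l : ℂ) ^ 2) := by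

  have hk' : (k : ℂ) ≠ 0 := by exact_mod_cast hk.ne'
  have hl' : (l : ℂ) ≠ 0 := by exact_mod_cast hl.ne'
  have hpi : (π : ℂ) ≠ 0 := by exact_mod_cast Real.pi_ne_zero
  have ha : 0 < k * l := mul_pos hk hl
  have hr := reduce ha.le calI0 calI1 (calI0_cont ha.le) (calI1_cont ha.le)
  rw [key ha] at hr
  have h1 : ∀ x : ℝ, Idelta k l x = (1 / ((k : ℂ) ^ 3 * l ^ 2)) *
      ((fun u : ℝ => ((u : ℂ) ^ 2 * (calI0 u + calI0 (k * l - u)) +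
        u * (calI1 (k * l - u) - calI1 u))) (k * x)) := by
    intro x
    unfold Idelta Igamma
    simp only [mul_sub]
    push_cast
    field_simp
  simp_rw [h1]
  rw [intervalIntegral.integral_const_mul,
    intervalIntegral.integral_comp_mul_left (fun u : ℝ => ((u : ℂ) ^ 2 * (calI0 u + calI0 (k * l - u)) +
        u * (calI1 (k * l - u) - calI1 u))) hk.ne', mul_zero, hr]
  have h2 : (∫ x in (0:ℝ)..(k * l),
      ((l ^ 2 - (2 * l / k) * x + (2 / k ^ 2) * x ^ 2 : ℝ) : ℂ) * calI0 x)
      = (1 / (k : ℂ) ^ 2) * ∫ u in (0:ℝ)..(k * l),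
        (((k * l : ℝ) : ℂ) ^ 2 - 2 * ((k * l : ℝ) : ℂ) * u + 2 * u ^ 2) * calI0 u := by
    rw [← intervalIntegral.integral_const_mul]
    refine intervalIntegral.integral_congr fun u _ => ?_
    push_cast
    field_simp
  rw [h2, Complex.real_smul]
  generalize (∫ u in (0:ℝ)..(k * l),
        (((k * l : ℝ) : ℂ) ^ 2 - 2 * ((k * l : ℝ) : ℂ) * u + 2 * u ^ 2) * calI0 u) = A
  push_cast
  field_simp
  ring
end

section
/- For all reals k, l > 0, the Galerkin single-layer self-integral with first-neighbor-node linear weights satisfies: (i/4)·∫₀^l ∫_{−x}^{l−x} H₀⁽¹⁾(k|x'|)·(1 − x/l)·((x'+x)/l) dx' dx = −A + (i/(4k²))·Γ₀(kl), where A denotes the coincident-node integral A = (i/4)·∫₀^l ∫_{−x}^{l−x} H₀⁽¹⁾(k|x'|)·(1 − x/l)·(1 − (x'+x)/l) dx' dx. -/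
open MeasureTheory Set Filter Topology Real intervalIntegral

/-- `Γ₀(σ) = ∫₀^σ 𝓘₀(x) dx`. -/
noncomputable def Gamma0 (σ : ℝ) : ℂ := ∫ x in (0:ℝ)..σ, calI0 x

lemma aux_bound (x t : ℝ) (hx : 0 < x) (ht : 0 < t) :
    Real.exp (-x * Real.sinh t) ≤
      x ^ (-(1/2) : ℝ) * (2 ^ (1/2 : ℝ) * (t ^ (-(1/2) : ℝ) * Real.exp (-(1/4) * t))) := by
  have h1 : t * Real.exp (t / 2) / 2 ≤ Real.sinh t := by
    have e : Real.sinh t = 2 * Real.sinh (t/2) * Real.cosh (t/2) := by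
      rw [← Real.sinh_two_mul]; ring_nf
    have a : t / 2 ≤ Real.sinh (t/2) := Real.self_le_sinh_iff.2 (by positivity)
    have b : Real.exp (t/2) / 2 ≤ Real.cosh (t/2) := by
      rw [Real.cosh_eq]; have := Real.exp_pos (-(t/2)); linarith
    rw [e]
    have := mul_le_mul a b (by positivity) (by linarith)
    linarith
  set y := x * (t * Real.exp (t / 2) / 2) with hy
  have hy0 : 0 < y := by positivity
  have h2 : Real.exp (-x * Real.sinh t) ≤ Real.exp (-y) := by
    apply Real.exp_le_exp.2
    have := mul_le_mul_of_nonneg_left h1 hx.le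
    linarith
  have h3 : Real.exp (-y) ≤ y ^ (-(1/2) : ℝ) := by
    rw [Real.rpow_def_of_pos hy0]
    apply Real.exp_le_exp.2
    have := Real.log_le_sub_one_of_pos hy0
    nlinarith
  refine h2.trans (h3.trans (le_of_eq ?_))
  have e1 : y = x * (2⁻¹ * (t * Real.exp (t/2))) := by rw [hy]; ring
  rw [e1, Real.mul_rpow hx.le (by positivity), Real.mul_rpow (by norm_num) (by positivity),
    Real.mul_rpow ht.le (by positivity), ← Real.exp_mul, Real.inv_rpow (by norm_num),
    ← Real.rpow_neg (by norm_num), neg_neg]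
  congr 4
  ring

lemma aux_K (a : ℝ) (ha : 0 ≤ a) :
    IntervalIntegrable (fun x => ∫ t in Set.Ioi (0:ℝ), 2 * Real.exp (-x * Real.sinh t))
      volume 0 a := by
  rw [intervalIntegrable_iff_integrableOn_Ioc_of_le ha]
  have hf : Integrable (fun x : ℝ => x ^ (-(1/2) : ℝ)) (volume.restrict (Ioc 0 a)) := by
    have := intervalIntegral.intervalIntegrable_rpow' (a := 0) (b := a) (r := -(1/2)) (by norm_num)
    rwa [intervalIntegrable_iff_integrableOn_Ioc_of_le ha] at this
  have hg : Integrable (fun t : ℝ => 2 ^ (1/2 : ℝ) * (t ^ (-(1/2) : ℝ) * Real.exp (-(1/4) * t)))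
      (volume.restrict (Ioi 0)) := by
    apply Integrable.const_mul
    have := integrableOn_rpow_mul_exp_neg_mul_rpow (p := 1) (s := -(1/2)) (b := 1/4)
      (by norm_num) (by norm_num) (by norm_num)
    simpa [IntegrableOn] using this
  have hp := (hf.mul_prod hg).const_mul 2
  have hm : Integrable (fun z : ℝ × ℝ => 2 * Real.exp (-z.1 * Real.sinh z.2))
      ((volume.restrict (Ioc 0 a)).prod (volume.restrict (Ioi 0))) := by
    refine hp.mono' (by fun_prop) ?_
    rw [Measure.prod_restrict]
    refine (ae_restrict_iff' (measurableSet_Ioc.prod measurableSet_Ioi)).2 (ae_of_all _ ?_)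
    rintro ⟨x, t⟩ ⟨hx, ht⟩
    have := aux_bound x t hx.1 ht
    simp only [Real.norm_eq_abs]
    rw [abs_of_pos (by positivity)]
    linarith
  exact hm.integral_prod_left

lemma aux_hankel (a : ℝ) (ha : 0 ≤ a) : IntervalIntegrable (hankelH1 0) volume 0 a := by
  have hJ : Continuous (besselJ 0) := by
    unfold besselJ
    exact continuous_const.mul
      (intervalIntegral.continuous_parametric_intervalIntegral_of_continuous' (by fun_prop) _ _)
  have hY1 : Continuous (fun x : ℝ => (1 / π) * (∫ τ in (0:ℝ)..π,
      Real.sin (x * Real.sin τ - (0:ℕ) * τ))) :=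
    continuous_const.mul
      (intervalIntegral.continuous_parametric_intervalIntegral_of_continuous' (by fun_prop) _ _)
  have hY : IntervalIntegrable (besselY 0) volume 0 a := by
    have := (hY1.intervalIntegrable (μ := volume) 0 a).sub ((aux_K a ha).const_mul (1 / π))
    convert this using 1
    funext x
    simp [besselY]
    norm_num
  have hY' : IntervalIntegrable (fun x => (besselY 0 x : ℂ)) volume 0 a := 
    ⟨hY.1.ofReal, hY.2.ofReal⟩
  have := ((Complex.continuous_ofReal.comp hJ).intervalIntegrable (μ := volume) 0 a).add
    (hY'.const_mul Complex.I)
  exact this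

lemma aux_f (k : ℝ) (hk : 0 < k) (a b : ℝ) :
    IntervalIntegrable (fun x => hankelH1 0 (k * |x|)) volume a b := by
  have h0 : ∀ c : ℝ, 0 ≤ c → IntervalIntegrable (fun x => hankelH1 0 (k * |x|)) volume 0 c := by
    intro c hc
    have := (aux_hankel (k * c) (by positivity)).comp_mul_left (c := k)
    rw [zero_div, mul_div_cancel_left₀ _ hk.ne'] at this
    refine this.congr ?_
    intro x hx
    rw [uIoc_of_le hc] at hx
    simp [abs_of_pos hx.1]
  have h1 : ∀ c : ℝ, IntervalIntegrable (fun x => hankelH1 0 (k * |x|)) volume 0 c := by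
    intro c
    rcases le_total 0 c with hc | hc
    · exact h0 c hc
    · have := (IntervalIntegrable.iff_comp_neg).1 (h0 (-c) (by linarith))
      simpa using this
  exact (h1 a).symm.trans (h1 b)

lemma aux_cont (f : ℝ → ℂ) (hf : ∀ a b, IntervalIntegrable f volume a b) (l : ℝ) :
    Continuous (fun x => ∫ y in (-x)..(l - x), f y) := by
  have hP := intervalIntegral.continuous_primitive hf 0
  have : (fun x => ∫ y in (-x)..(l - x), f y)
      = fun x => (∫ y in (0:ℝ)..(l - x), f y) - ∫ y in (0:ℝ)..(-x), f y := by
    funext x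
    rw [intervalIntegral.integral_interval_sub_left (hf _ _) (hf _ _)]
  rw [this]
  exact (hP.comp (by fun_prop : Continuous fun x : ℝ => l - x)).sub
    (hP.comp (by fun_prop : Continuous fun x : ℝ => -x))

/-- the Galerkin single-layer self-integral with first-neighbor-node
weights equals `−A + (i/(4k²))·Γ₀(kl)` where `A` is the coincident-node integral. -/
theorem statement13 (k l : ℝ) (hk : 0 < k) (hl : 0 < l) :
    (Complex.I / 4) * ∫ x in (0:ℝ)..l, ∫ x' in (-x)..(l - x),
        hankelH1 0 (k * |x'|) * ((1 - x / l : ℝ) : ℂ) * (((x' + x) / l : ℝ) : ℂ)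
      = -((Complex.I / 4) * ∫ x in (0:ℝ)..l, ∫ x' in (-x)..(l - x),
            hankelH1 0 (k * |x'|) * ((1 - x / l : ℝ) : ℂ) * ((1 - (x' + x) / l : ℝ) : ℂ))
        + (Complex.I / (4 * (k : ℂ) ^ 2)) * Gamma0 (k * l) := by
  set f : ℝ → ℂ := fun x => hankelH1 0 (k * |x|) with hfdef
  have hf : ∀ a b, IntervalIntegrable f volume a b := aux_f k hk
  have hfx : ∀ a b, IntervalIntegrable (fun y => f y * (y : ℂ)) volume a b := fun a b =>
    (hf a b).mul_continuousOn Complex.continuous_ofReal.continuousOn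
  have hlC : (l : ℂ) ≠ 0 := by exact_mod_cast hl.ne'
  have hkC : (k : ℂ) ≠ 0 := by exact_mod_cast hk.ne'
  have c0 := aux_cont f hf l
  have c1 := aux_cont _ hfx l
  have e1 : ∀ x : ℝ, (∫ x' in (-x)..(l - x),
        hankelH1 0 (k * |x'|) * ((1 - x / l : ℝ) : ℂ) * (((x' + x) / l : ℝ) : ℂ))
      = ((1 - x / l : ℝ) : ℂ) / l * ((∫ y in (-x)..(l - x), f y * (y : ℂ))
        + x * ∫ y in (-x)..(l - x), f y) := by
    intro x
    rw [← intervalIntegral.integral_const_mul, ← intervalIntegral.integral_add (hfx _ _)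
      ((hf _ _).const_mul _), ← intervalIntegral.integral_const_mul]
    congr 1
    funext y
    simp only [hfdef]
    push_cast
    field_simp
  have e2 : ∀ x : ℝ, (∫ x' in (-x)..(l - x),
        hankelH1 0 (k * |x'|) * ((1 - x / l : ℝ) : ℂ) * ((1 - (x' + x) / l : ℝ) : ℂ))
      = ((1 - x / l : ℝ) : ℂ) * (∫ y in (-x)..(l - x), f y)
        - ((1 - x / l : ℝ) : ℂ) / l * ((∫ y in (-x)..(l - x), f y * (y : ℂ))
        + x * ∫ y in (-x)..(l - x), f y) := by
    intro x
    rw [← intervalIntegral.integral_const_mul (x : ℂ), ← intervalIntegral.integral_add (hfx _ _)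
      ((hf _ _).const_mul _), ← intervalIntegral.integral_const_mul,
      ← intervalIntegral.integral_const_mul, ← intervalIntegral.integral_sub
      ((hf _ _).const_mul _) (((hfx _ _).add ((hf _ _).const_mul _)).const_mul _)]
    congr 1
    funext y
    simp only [hfdef]
    push_cast
    field_simp
  simp_rw [e1, e2]
  have cw : Continuous (fun x : ℝ => ((1 - x / l : ℝ) : ℂ)) := by fun_prop
  have cx : Continuous (fun x : ℝ => (x : ℂ)) := Complex.continuous_ofReal
  have i0 : Continuous (fun x : ℝ => ((1 - x / l : ℝ) : ℂ) * (∫ y in (-x)..(l - x), f y)) :=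
    cw.mul c0
  have i1 : Continuous (fun x : ℝ => ((1 - x / l : ℝ) : ℂ) / l *
      ((∫ y in (-x)..(l - x), f y * (y : ℂ)) + x * ∫ y in (-x)..(l - x), f y)) :=
    (cw.div_const _).mul (c1.add (cx.mul c0))
  rw [intervalIntegral.integral_sub (i0.intervalIntegrable _ _) (i1.intervalIntegrable _ _)]
  set G : ℝ → ℂ := fun x => ∫ y in (0:ℝ)..x, f y with hG
  have cG : Continuous G := intervalIntegral.continuous_primitive hf 0
  have e3 : ∀ x : ℝ, (∫ y in (-x)..(l - x), f y) = G x + G (l - x) := by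
    intro x
    rw [← intervalIntegral.integral_add_adjacent_intervals (hf (-x) 0) (hf 0 (l - x))]
    congr 1
    have := intervalIntegral.integral_comp_neg (a := 0) (b := x) f
    rw [neg_zero] at this
    rw [← this]
    simp [hG, hfdef]
  have key : (∫ x in (0:ℝ)..l, ((1 - x / l : ℝ) : ℂ) * (∫ y in (-x)..(l - x), f y))
      = ∫ x in (0:ℝ)..l, G x := by
    simp_rw [e3, mul_add]
    have cA : Continuous (fun x : ℝ => ((1 - x / l : ℝ) : ℂ) * G x) := cw.mul cG
    have cB : Continuous (fun x : ℝ => ((1 - x / l : ℝ) : ℂ) * G (l - x)) :=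
      cw.mul (cG.comp (by fun_prop : Continuous fun x : ℝ => l - x))
    have cC : Continuous (fun x : ℝ => ((x / l : ℝ) : ℂ) * G x) :=
      (by fun_prop : Continuous (fun x : ℝ => ((x / l : ℝ) : ℂ))).mul cG
    rw [intervalIntegral.integral_add (cA.intervalIntegrable _ _) (cB.intervalIntegrable _ _)]
    have hs := intervalIntegral.integral_comp_sub_left (a := 0) (b := l)
      (fun x : ℝ => ((x / l : ℝ) : ℂ) * G x) l
    rw [sub_self, sub_zero] at hs
    have e4 : ∀ x : ℝ, ((1 - x / l : ℝ) : ℂ) * G (l - x) = (((l - x) / l : ℝ) : ℂ) * G (l - x) := by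
      intro x
      rw [sub_div, div_self hl.ne']
    simp_rw [e4]
    rw [hs, ← intervalIntegral.integral_add (cA.intervalIntegrable _ _)
      (cC.intervalIntegrable _ _)]
    congr 1
    funext x
    push_cast
    ring
  have e5 : (∫ x in (0:ℝ)..l, G x) = 1 / (k : ℂ) ^ 2 * Gamma0 (k * l) := by
    have e6 : ∀ x ∈ uIcc 0 l, G x = (k : ℂ)⁻¹ * calI0 (k * x) := by
      intro x hx
      rw [uIcc_of_le hl.le] at hx
      have h7 : G x = ∫ y in (0:ℝ)..x, hankelH1 0 (k * y) := by
        apply intervalIntegral.integral_congr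
        intro y hy
        rw [uIcc_of_le hx.1] at hy
        simp [hfdef, abs_of_nonneg hy.1]
      rw [h7, intervalIntegral.integral_comp_mul_left _ hk.ne', mul_zero, calI0,
        Complex.real_smul, Complex.ofReal_inv]
    rw [intervalIntegral.integral_congr e6, intervalIntegral.integral_const_mul,
      intervalIntegral.integral_comp_mul_left _ hk.ne', mul_zero, ← Gamma0,
      Complex.real_smul, Complex.ofReal_inv]
    field_simp
  rw [key, e5]
  field_simp
  ring
end
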